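/- For every f ∈ Aug(H), the image of the subspace A_{r,+}^0 of admissible words under the rooted tree map f̃ is contained in the kernel of the multiple L-value evaluation map L: f̃(A_{r,+}^0) ⊆ ker L. -/

import Mathlib

open FreeAlgebra

/-- Alphabet of `A_1 = ℚ⟨x,y⟩`. -/
inductive LetA : Type | x : LetA | y : LetA

/-- Alphabet of `A_r = ℚ⟨x, y_s : s ∈ μ_r⟩`; the group `G` plays the role of `μ_r`. -/
inductive LetR (G : Type) : Type | x : LetR G | y : G → LetR G

/-- `A_1 = ℚ⟨x, y⟩`. -/
abbrev A1 : Type := FreeAlgebra ℚ LetA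

/-- `A_r = ℚ⟨x, y_s : s ∈ μ_r⟩`. -/
abbrev Ar (G : Type) : Type := FreeAlgebra ℚ (LetR G)

noncomputable def X1 : A1 := ι ℚ LetA.x
noncomputable def Y1 : A1 := ι ℚ LetA.y

variable {G : Type} [CommGroup G]

noncomputable def Xr : Ar G := ι ℚ LetR.x
noncomputable def Yr (s : G) : Ar G := ι ℚ (LetR.y s)

/-- `z = x + y_1`. -/
noncomputable def zet : Ar G := Xr + Yr 1

open scoped Classical in
/-- `z_s^δ = x + δ(s) y_s` with `δ(1) = 0`, `δ(s) = 1` otherwise. -/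
noncomputable def zdel (s : G) : Ar G := if s = 1 then Xr else Xr + Yr s

/-- The involutive automorphism `φ` of `A_r`: `φ(x) = z`, `φ(y_s) = z_s^δ - z`. -/
noncomputable def phi : Ar G →ₐ[ℚ] Ar G :=
  lift ℚ (fun l => match l with
    | LetR.x => zet
    | LetR.y s => zdel s - zet)

/-- The natural embedding `A_1 → A_r`, `x ↦ x`, `y ↦ y_1`. -/
noncomputable def jm : A1 →ₐ[ℚ] Ar G :=
  lift ℚ (fun l => match l with
    | LetA.x => Xr
    | LetA.y => Yr 1)

open scoped Classical in
/-- The anti-automorphism `τ` of `A_r`: `τ(x) = y_1`, `τ(y_1) = x`, `τ(y_s) = -y_s` (`s ≠ 1`). -/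
noncomputable def tauR : Ar G →ₗ[ℚ] Ar G :=
  (MulOpposite.opLinearEquiv ℚ).symm.toLinearMap ∘ₗ
    (lift ℚ (fun l => match l with
      | LetR.x => MulOpposite.op (Yr 1)
      | LetR.y s => MulOpposite.op (if s = 1 then Xr else -(Yr s)) ) :
        Ar G →ₐ[ℚ] (Ar G)ᵐᵒᵖ).toLinearMap

/-- The anti-automorphism `τ` of `A_1`: `τ(x) = y`, `τ(y) = x`. -/
noncomputable def tau1 : A1 →ₗ[ℚ] A1 :=
  (MulOpposite.opLinearEquiv ℚ).symm.toLinearMap ∘ₗ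
    (lift ℚ (fun l => match l with
      | LetA.x => MulOpposite.op Y1
      | LetA.y => MulOpposite.op X1) : A1 →ₐ[ℚ] A1ᵐᵒᵖ).toLinearMap

/-- `wordP [(a₁,s₁),...,(a_l,s_l)] = x^{a₁} y_{s₁} ⋯ x^{a_l} y_{s_l}`,
i.e. the word `z_{a₁+1, s₁} ⋯ z_{a_l+1, s_l}`. -/
noncomputable def wordP (L : List (ℕ × G)) : Ar G :=
  (L.map (fun p => Xr ^ p.1 * Yr p.2)).prod

/-- Cumulative-product reindexing of subscripts: this realizes the composition `I ∘ M_s`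
on subscript lists, sending `(s₁, s₂, …, s_l)` to `(s s₁, s s₁ s₂, …, s s₁ ⋯ s_l)`. -/
def cumul : G → List (ℕ × G) → List (ℕ × G)
  | _, [] => []
  | g, p :: L => (p.1, g * p.2) :: cumul (g * p.2) L

/-- All the data entering the definition of the diamond products `⋄_s`:
the harmonic product `*`, the maps `ψ_s = φ ∘ I ∘ M_s`, and the family of
`ℚ`-bilinear diamond products `D s : A_1 × A_r → A_r` (together with the
corestriction `D1` of `⋄_1` to `A_1 × A_1 → A_1`), each characterized by its
defining recursive rules. -/
structure DiamondSetup (G : Type) [CommGroup G] where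
  /-- the harmonic product -/
  hst : Ar G →ₗ[ℚ] Ar G →ₗ[ℚ] Ar G
  one_hst : ∀ w, hst 1 w = w
  hst_one : ∀ v, hst v 1 = v
  hst_xr : ∀ v w, hst (v * Xr) w = hst v w * Xr
  hst_xl : ∀ v w, hst v (w * Xr) = hst v w * Xr
  hst_yy : ∀ (v w : Ar G) (s t : G), hst (v * Yr s) (w * Yr t) =
      hst v (w * Yr t) * Yr s + hst (v * Yr s) w * Yr t + hst v w * (Xr * Yr (s * t))
  /-- the linear automorphisms `ψ_s = φ ∘ I ∘ M_s` -/
  psi : G → (Ar G ≃ₗ[ℚ] Ar G)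
  psi_spec : ∀ (s : G) (L : List (ℕ × G)) (a : ℕ),
      psi s (wordP L * Xr ^ a) = phi (wordP (cumul s L) * Xr ^ a)
  /-- the diamond products `⋄_s : A_1 × A_r → A_r` -/
  D : G → A1 →ₗ[ℚ] Ar G →ₗ[ℚ] Ar G
  one_D : ∀ (s : G) (w : Ar G), D s 1 w = w
  D_one : ∀ (s : G) (v : A1), D s v 1 = psi s (phi (jm v))
  Dxx : ∀ (s : G) (v : A1) (w : Ar G), D s (v * X1) (w * Xr) =
      D s v (w * Xr) * Xr - D s (v * Y1) w * Xr
  Dyx : ∀ (s : G) (v : A1) (w : Ar G), D s (v * Y1) (w * Xr) =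
      D s v (w * Xr) * Yr 1 + D s (v * Y1) w * Xr
  Dxy : ∀ (s : G) (v : A1) (w : Ar G), D s (v * X1) (w * Yr 1) =
      D s v (w * Yr 1) * Xr + D s (v * X1) w * Yr 1
  Dyy : ∀ (s : G) (v : A1) (w : Ar G), D s (v * Y1) (w * Yr 1) =
      D s v (w * Yr 1) * Yr 1 - D s (v * X1) w * Yr 1
  Dxyt : ∀ (s t : G), t ≠ 1 → ∀ (v : A1) (w : Ar G), D s (v * X1) (w * Yr t) =
      D s v (w * Yr t) * Xr + D s v (w * (Xr + Yr t)) * Yr t - D s (v * Y1) w * Yr t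
  Dyyt : ∀ (s t : G), t ≠ 1 → ∀ (v : A1) (w : Ar G), D s (v * Y1) (w * Yr t) =
      D s v (w * Yr t) * Yr 1 - D s v (w * (Xr + Yr t)) * Yr t + D s (v * Y1) w * Yr t
  /-- `⋄_1` as a product `A_1 × A_1 → A_1` -/
  D1 : A1 →ₗ[ℚ] A1 →ₗ[ℚ] A1
  D1_spec : ∀ u v : A1, jm (D1 u v) = D 1 u (jm v)

open TensorProduct in
/-- Evaluation of a family of endomorphisms at a fixed element, as a linear map. -/
noncomputable def evalT {G : Type} [CommGroup G] {H : Type} [CommRing H] [HopfAlgebra ℚ H]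
    (T : H →ₐ[ℚ] Module.End ℚ (Ar G)) (w : Ar G) : H →ₗ[ℚ] Ar G :=
  (LinearMap.applyₗ w).comp T.toLinearMap

open TensorProduct in
/-- The linear map `H ⊗ H → A_r` induced by the bilinear map `(a, b) ↦ (T a)(w) ⋅ (T b)(v)`. -/
noncomputable def Tpair {G : Type} [CommGroup G] {H : Type} [CommRing H] [HopfAlgebra ℚ H]
    (T : H →ₐ[ℚ] Module.End ℚ (Ar G)) (w v : Ar G) : H ⊗[ℚ] H →ₗ[ℚ] Ar G :=
  TensorProduct.lift (((LinearMap.mul ℚ (Ar G)).compl₂ (evalT T v)).comp (evalT T w))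

open TensorProduct in
/-- The Connes–Kreimer Hopf algebra of rooted forests `H` together with the grafting
operator `B_+`, the rooted tree maps `f ↦ f̃`, and the polynomials `F_f`, `G_f ∈ A_1`,
each characterized by its defining properties. -/
structure CKSetup (G : Type) [CommGroup G] (H : Type) [CommRing H] [HopfAlgebra ℚ H] where
  /-- the diamond/harmonic data on `A_1`, `A_r` -/
  ds : DiamondSetup G
  /-- the grafting operator `B_+` -/
  Bp : H →ₗ[ℚ] H
  /-- the Hochschild 1-cocycle property `Δ(B_+(f)) = B_+(f) ⊗ 𝟙 + (id ⊗ B_+)(Δ f)` -/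
  Bp_cocycle : ∀ f : H, Coalgebra.comul (R := ℚ) (Bp f) =
      (Bp f) ⊗ₜ[ℚ] (1 : H) + (TensorProduct.map LinearMap.id Bp) (Coalgebra.comul (R := ℚ) f)
  /-- `H` is generated by rooted forests: it is the smallest subspace containing `1` and
  closed under multiplication and `B_+`. -/
  hgen : ∀ P : Submodule ℚ H, (1 : H) ∈ P → (∀ a b : H, a ∈ P → b ∈ P → a * b ∈ P) →
      (∀ a ∈ P, Bp a ∈ P) → ∀ h : H, h ∈ P
  /-- the rooted tree maps `f ↦ f̃`, an algebra homomorphism `H → End(A_r)` -/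
  T : H →ₐ[ℚ] Module.End ℚ (Ar G)
  /-- rule (I): `•̃(z_s^δ) = z_s^δ (z - z_s^δ)` -/
  T_dot_zdel : ∀ s : G, T (Bp 1) (zdel s) = zdel s * (zet - zdel s)
  /-- rule (I): `•̃(z) = 0` -/
  T_dot_z : T (Bp 1) (zet : Ar G) = 0
  /-- rule (II): `B_+(f)~(z_s^δ) = R_{z-z_s^δ} R_{2z-z_s^δ} R_{z-z_s^δ}^{-1} f̃(z_s^δ)` -/
  T_graft : ∀ f : H, Coalgebra.counit (R := ℚ) f = 0 → ∀ (s : G) (u : Ar G),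
      T f (zdel s) = u * (zet - zdel s) →
      T (Bp f) (zdel s) = u * ((2 : ℚ) • zet - zdel s) * (zet - zdel s)
  /-- `f̃(z_s^δ)` always ends with `z - z_s^δ` (so that rule (II) makes sense) -/
  T_ends : ∀ f : H, Coalgebra.counit (R := ℚ) f = 0 → ∀ s : G, ∃ u : Ar G,
      T f (zdel s) = u * (zet - zdel s)
  /-- rule (II): `B_+(f)~(z) = 0` -/
  T_graft_z : ∀ f : H, T (Bp f) (zet : Ar G) = 0
  /-- rule (IV): `f̃(wv) = M(Δ(f)~(w ⊗ v))` for `v ∈ {z, z_s^δ}` -/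
  T_coprod : ∀ (f : H) (w v : Ar G), (v = zet ∨ ∃ s : G, v = zdel s) →
      T f (w * v) = Tpair T w v (Coalgebra.comul (R := ℚ) f)
  /-- the polynomials `F_f ∈ A_1` -/
  F : H →ₗ[ℚ] A1
  F_one : F 1 = 1
  F_dot : F (Bp 1) = Y1
  F_ends : ∀ f : H, Coalgebra.counit (R := ℚ) f = 0 → ∃ u : A1, F f = u * Y1
  /-- `F_{B_+(f)} = R_y R_{x+2y} R_y^{-1}(F_f)` for `f ≠ 𝟙` -/
  F_graft : ∀ f : H, Coalgebra.counit (R := ℚ) f = 0 → ∀ u : A1, F f = u * Y1 →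
      F (Bp f) = u * (X1 + (2 : ℚ) • Y1) * Y1
  /-- `F_{gh} = F_g ⋄_1 F_h` -/
  F_mul : ∀ g h : H, F (g * h) = ds.D1 (F g) (F h)
  /-- the polynomials `G_f ∈ A_1` -/
  Gm : H →ₗ[ℚ] A1
  Gm_one : Gm 1 = 1
  Gm_dot : Gm (Bp 1) = -Y1
  /-- `G_{B_+(f)} = L_{2x+y}(G_f)` for `f ≠ 𝟙` -/
  Gm_graft : ∀ f : H, Coalgebra.counit (R := ℚ) f = 0 →
      Gm (Bp f) = ((2 : ℚ) • X1 + Y1) * Gm f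
  /-- `G_{gh} = G_g ⋄_1 G_h` -/
  Gm_mul : ∀ g h : H, Gm (g * h) = ds.D1 (Gm g) (Gm h)

open scoped Classical in
/-- The partial sum `Σ_{m > m₁ > ⋯ > m_l > 0} s₁^{m₁-m₂} ⋯ s_{l-1}^{m_{l-1}-m_l} s_l^{m_l}
/ (m₁^{k₁} ⋯ m_l^{k_l})` of the multiple `L`-series. -/
noncomputable def plSum (r : ℕ) (l : ℕ) (k : Fin l → ℕ) (s : Fin l → (rootsOfUnity r ℂ))
    (m : ℕ) : ℂ :=
  ∑ g ∈ Finset.univ.filter (fun g : Fin l → Fin m =>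
      (∀ i j : Fin l, i < j → (g j : ℕ) < (g i : ℕ)) ∧ ∀ i : Fin l, 0 < (g i : ℕ)),
    (∏ i : Fin l, (((s i : ℂˣ) : ℂ)) ^
        ((g i : ℕ) - (if h : (i : ℕ) + 1 < l then (g ⟨(i : ℕ) + 1, h⟩ : ℕ) else 0)))
      / (∏ i : Fin l, ((g i : ℕ) : ℂ) ^ (k i))

/-- The admissible word `z_{k₁,s₁} ⋯ z_{k_l,s_l} = x^{k₁-1} y_{s₁} ⋯ x^{k_l-1} y_{s_l}`. -/
noncomputable def wAdm {G : Type} [CommGroup G] (l : ℕ) (k : Fin l → ℕ) (s : Fin l → G) :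
    Ar G :=
  (List.ofFn fun i : Fin l => Xr ^ (k i - 1) * Yr (s i)).prod

/-- `A_{r,+}^0`: the span of admissible words `z_{k₁,s₁} ⋯ z_{k_l,s_l}` with `l ≥ 1`,
`k_i ≥ 1` and `(k₁, s₁) ≠ (1, 1)`. -/
noncomputable def A0plus (G : Type) [CommGroup G] : Submodule ℚ (Ar G) :=
  Submodule.span ℚ {a : Ar G | ∃ (l : ℕ) (hl : 0 < l) (k : Fin l → ℕ) (s : Fin l → G),
    (∀ i, 1 ≤ k i) ∧ (2 ≤ k ⟨0, hl⟩ ∨ s ⟨0, hl⟩ ≠ 1) ∧ a = wAdm l k s}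

namespace RTM

/-- `z = x + y` in `A_1`. -/
noncomputable def Z1 : A1 := X1 + Y1

theorem indL (S : Submodule ℚ (Ar G)) (h1 : (1 : Ar G) ∈ S)
    (hz : ∀ w ∈ S, zet * w ∈ S) (ht : ∀ t : G, ∀ w ∈ S, zdel t * w ∈ S) (w : Ar G) : w ∈ S := by
  have hx : ∀ w ∈ S, Xr * w ∈ S := by
    intro w hw
    have := ht 1 w hw
    simpa [zdel] using this
  have hy : ∀ t, ∀ w ∈ S, Yr t * w ∈ S := by
    intro t w hw
    by_cases h : t = 1
    · subst h
      have := S.sub_mem (hz w hw) (hx w hw)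
      rw [← sub_mul] at this
      simpa [zet] using this
    · have := S.sub_mem (ht t w hw) (hx w hw)
      rw [← sub_mul] at this
      simpa [zdel, h] using this
  have key : ∀ a : Ar G, ∀ w ∈ S, a * w ∈ S := by
    intro a
    induction a using FreeAlgebra.induction with
    | grade0 r => intro w hw; rw [← Algebra.smul_def]; exact S.smul_mem _ hw
    | grade1 l =>
      cases l with
      | x => exact hx
      | y t => exact hy t
    | mul a b ha hb => intro w hw; rw [mul_assoc]; exact ha _ (hb _ hw)
    | add a b ha hb => intro w hw; rw [add_mul]; exact S.add_mem (ha _ hw) (hb _ hw)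
  simpa using key w 1 h1

theorem indRletter (S : Submodule ℚ (Ar G)) (h1 : (1 : Ar G) ∈ S)
    (hx : ∀ w ∈ S, w * Xr ∈ S) (hy : ∀ t : G, ∀ w ∈ S, w * Yr t ∈ S) (w : Ar G) : w ∈ S := by
  have key : ∀ a : Ar G, ∀ w ∈ S, w * a ∈ S := by
    intro a
    induction a using FreeAlgebra.induction with
    | grade0 r => intro w hw; rw [← Algebra.commutes, ← Algebra.smul_def]; exact S.smul_mem _ hw
    | grade1 l =>
      cases l with
      | x => exact hx
      | y t => exact hy t
    | mul a b ha hb => intro w hw; rw [← mul_assoc]; exact hb _ (ha _ hw)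
    | add a b ha hb => intro w hw; rw [mul_add]; exact S.add_mem (ha _ hw) (hb _ hw)
  simpa using key w 1 h1

theorem indR (S : Submodule ℚ (Ar G)) (h1 : (1 : Ar G) ∈ S)
    (hz : ∀ w ∈ S, w * zet ∈ S) (ht : ∀ t : G, ∀ w ∈ S, w * zdel t ∈ S) (w : Ar G) : w ∈ S := by
  have hx : ∀ w ∈ S, w * Xr ∈ S := by
    intro w hw
    have := ht 1 w hw
    simpa [zdel] using this
  refine indRletter S h1 hx ?_ w
  intro t w hw
  by_cases h : t = 1
  · subst h
    have := S.sub_mem (hz w hw) (hx w hw)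
    rw [← mul_sub] at this
    simpa [zet] using this
  · have := S.sub_mem (ht t w hw) (hx w hw)
    rw [← mul_sub] at this
    simpa [zdel, h] using this

theorem indR1 (S : Submodule ℚ A1) (h1 : (1 : A1) ∈ S)
    (hx : ∀ w ∈ S, w * X1 ∈ S) (hy : ∀ w ∈ S, w * Y1 ∈ S) (w : A1) : w ∈ S := by
  have key : ∀ a : A1, ∀ w ∈ S, w * a ∈ S := by
    intro a
    induction a using FreeAlgebra.induction with
    | grade0 r => intro w hw; rw [← Algebra.commutes, ← Algebra.smul_def]; exact S.smul_mem _ hw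
    | grade1 l =>
      cases l with
      | x => exact hx
      | y => exact hy
    | mul a b ha hb => intro w hw; rw [← mul_assoc]; exact hb _ (ha _ hw)
    | add a b ha hb => intro w hw; rw [mul_add]; exact S.add_mem (ha _ hw) (hb _ hw)
  simpa using key w 1 h1

theorem indR1z (S : Submodule ℚ A1) (h1 : (1 : A1) ∈ S)
    (hz : ∀ w ∈ S, w * Z1 ∈ S) (hy : ∀ w ∈ S, w * Y1 ∈ S) (w : A1) : w ∈ S := by
  refine indR1 S h1 ?_ hy w
  intro w hw
  have := S.sub_mem (hz w hw) (hy w hw)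
  rw [← mul_sub] at this
  simpa [Z1] using this

theorem indL1 (S : Submodule ℚ A1) (h1 : (1 : A1) ∈ S)
    (hx : ∀ w ∈ S, X1 * w ∈ S) (hy : ∀ w ∈ S, Y1 * w ∈ S) (w : A1) : w ∈ S := by
  have key : ∀ a : A1, ∀ w ∈ S, a * w ∈ S := by
    intro a
    induction a using FreeAlgebra.induction with
    | grade0 r => intro w hw; rw [← Algebra.smul_def]; exact S.smul_mem _ hw
    | grade1 l =>
      cases l with
      | x => exact hx
      | y => exact hy
    | mul a b ha hb => intro w hw; rw [mul_assoc]; exact ha _ (hb _ hw)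
    | add a b ha hb => intro w hw; rw [add_mul]; exact S.add_mem (ha _ hw) (hb _ hw)
  simpa using key w 1 h1

theorem indL1z (S : Submodule ℚ A1) (h1 : (1 : A1) ∈ S)
    (hx : ∀ w ∈ S, X1 * w ∈ S) (hz : ∀ w ∈ S, Z1 * w ∈ S) (w : A1) : w ∈ S := by
  refine indL1 S h1 hx ?_ w
  intro w hw
  have := S.sub_mem (hz w hw) (hx w hw)
  rw [← sub_mul] at this
  simpa [Z1] using this

/-- the algebra map `x ↦ z_s`, `y ↦ z - z_s`. -/
noncomputable def eh (s : G) : A1 →ₐ[ℚ] Ar G :=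
  lift ℚ (fun l => match l with
    | LetA.x => zdel s
    | LetA.y => zet - zdel s)

theorem eh_x (s : G) : eh s X1 = zdel s := by simp [eh, X1]
theorem eh_y (s : G) : eh s Y1 = zet - zdel s := by simp [eh, Y1]
theorem eh_z (s : G) : eh s Z1 = zet := by simp [Z1, eh_x, eh_y]

noncomputable def Ph (s : G) : A1 →ₐ[ℚ] Ar G :=
  lift ℚ (fun l => match l with
    | LetA.x => zet
    | LetA.y => zdel s - zet)

noncomputable def ph1 : A1 →ₐ[ℚ] A1 :=
  lift ℚ (fun l => match l with
    | LetA.x => Z1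
    | LetA.y => - Y1)

theorem jm_x : (jm X1 : Ar G) = Xr := by simp [jm, X1]
theorem jm_y : (jm Y1 : Ar G) = Yr 1 := by simp [jm, Y1]
theorem jm_z : (jm Z1 : Ar G) = zet := by simp [Z1, jm_x, jm_y, zet]
theorem zdel_one : (zdel 1 : Ar G) = Xr := by simp [zdel]

theorem phi_x : (phi Xr : Ar G) = zet := by simp [phi, Xr]
theorem phi_y (s : G) : (phi (Yr s) : Ar G) = zdel s - zet := by simp [phi, Yr]

theorem phi_jm (v : A1) : (phi (jm v) : Ar G) = jm (ph1 v) := by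
  have : ((phi : Ar G →ₐ[ℚ] Ar G).comp jm) = (jm : A1 →ₐ[ℚ] Ar G).comp ph1 := by
    apply FreeAlgebra.hom_ext
    funext l
    cases l with
    | x =>
      change phi (jm X1) = jm (ph1 X1)
      rw [jm_x, phi_x]
      simp [ph1, X1, jm_z]
    | y =>
      change phi (jm Y1) = jm (ph1 Y1)
      rw [jm_y, phi_y, zdel_one]
      have : ph1 Y1 = -Y1 := by simp [ph1, Y1]
      rw [this, map_neg, jm_y]
      simp [zet]
  exact DFunLike.congr_fun this v

theorem Ph_ph1 (s : G) (v : A1) : Ph s (ph1 v) = eh s v := by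
  have : (Ph s).comp ph1 = eh s := by
    apply FreeAlgebra.hom_ext
    funext l
    cases l with
    | x =>
      change Ph s (ph1 X1) = eh s X1
      rw [eh_x]
      simp [ph1, X1, Y1, Ph, Z1]
    | y =>
      change Ph s (ph1 Y1) = eh s Y1
      rw [eh_y]
      simp [ph1, Y1, Ph]
  exact DFunLike.congr_fun this v

theorem cumul_ones (s : G) (l : List ℕ) :
    cumul s (l.map fun a => (a, (1 : G))) = l.map fun a => (a, s) := by
  induction l with
  | nil => rfl
  | cons a l ih => simp [cumul, ih]

theorem psi_jm (ds : DiamondSetup G) (s : G) (v : A1) : ds.psi s (jm v) = Ph s v := by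
  have h1 : v ∈ Submodule.span ℚ {v : A1 | ∃ (l : List ℕ) (a : ℕ),
      v = (l.map fun b => X1 ^ b * Y1).prod * X1 ^ a} := by
    refine indL1 _ ?_ ?_ ?_ v
    · apply Submodule.subset_span
      exact ⟨[], 0, by simp⟩
    · intro w hw
      induction hw using Submodule.span_induction with
      | mem w h =>
        obtain ⟨l, a, rfl⟩ := h
        apply Submodule.subset_span
        cases l with
        | nil => exact ⟨[], a + 1, by simp [pow_succ']⟩
        | cons b l => exact ⟨(b + 1) :: l, a, by simp [pow_succ', mul_assoc]⟩
      | zero => simp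
      | add x y _ _ hx hy => rw [mul_add]; exact Submodule.add_mem _ hx hy
      | smul r x _ hx => rw [mul_smul_comm]; exact Submodule.smul_mem _ _ hx
    · intro w hw
      induction hw using Submodule.span_induction with
      | mem w h =>
        obtain ⟨l, a, rfl⟩ := h
        apply Submodule.subset_span
        exact ⟨0 :: l, a, by simp [mul_assoc]⟩
      | zero => simp
      | add x y _ _ hx hy => rw [mul_add]; exact Submodule.add_mem _ hx hy
      | smul r x _ hx => rw [mul_smul_comm]; exact Submodule.smul_mem _ _ hx
  induction h1 using Submodule.span_induction with
  | mem w h =>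
    obtain ⟨l, a, rfl⟩ := h
    have e1 : (jm ((l.map fun b => X1 ^ b * Y1).prod * X1 ^ a) : Ar G)
        = wordP (l.map fun a => (a, (1 : G))) * Xr ^ a := by
      rw [map_mul, map_pow, jm_x, map_list_prod, wordP, List.map_map, List.map_map]
      congr 3
      funext b
      simp [jm_x, jm_y]
    have px : Ph s X1 = zet := by simp [Ph, X1]
    have py : Ph s Y1 = zdel s - zet := by simp [Ph, Y1]
    rw [e1, ds.psi_spec, cumul_ones]
    rw [map_mul, map_mul, map_pow, map_pow, phi_x, px, map_list_prod, wordP, map_list_prod,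
      List.map_map, List.map_map, List.map_map]
    congr 3
    funext b
    simp [phi_x, phi_y, px, py]
  | zero => simp
  | add x y _ _ hx hy => simp only [map_add, hx, hy]
  | smul r x _ hx => simp only [map_smul, hx]

theorem D_one' (ds : DiamondSetup G) (s : G) (v : A1) : ds.D s v 1 = eh s v := by
  rw [ds.D_one, phi_jm, psi_jm, Ph_ph1]

theorem D_zl (ds : DiamondSetup G) (s : G) (v : A1) (w : Ar G) :
    ds.D s (v * Z1) w = ds.D s v w * zet := by
  let S : Submodule ℚ (Ar G) :=
    LinearMap.eqLocus (ds.D s (v * Z1)) ((LinearMap.mulRight ℚ zet).comp (ds.D s v))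
  have : w ∈ S := by
    apply indRletter S
    · change ds.D s (v * Z1) 1 = ds.D s v 1 * zet
      rw [D_one', D_one', map_mul, eh_z]
    · intro w _
      change ds.D s (v * Z1) (w * Xr) = ds.D s v (w * Xr) * zet
      rw [Z1, mul_add, map_add, LinearMap.add_apply, ds.Dxx, ds.Dyx, zet, mul_add]
      abel
    · intro t w _
      change ds.D s (v * Z1) (w * Yr t) = ds.D s v (w * Yr t) * zet
      rw [Z1, mul_add, map_add, LinearMap.add_apply, zet, mul_add]
      by_cases h : t = 1
      · subst h
        rw [ds.Dxy, ds.Dyy]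
        abel
      · rw [ds.Dxyt s t h, ds.Dyyt s t h]
        abel
  exact this

theorem D_zr (ds : DiamondSetup G) (s : G) (v : A1) : ∀ (w : Ar G),
    ds.D s v (w * zet) = ds.D s v w * zet := by
  let S : Submodule ℚ A1 :=
    { carrier := {v | ∀ w, ds.D s v (w * zet) = ds.D s v w * zet}
      zero_mem' := by intro w; simp
      add_mem' := by
        intro a b ha hb w
        simp only [map_add, LinearMap.add_apply, ha w, hb w, add_mul]
      smul_mem' := by
        intro r a ha w
        simp only [map_smul, LinearMap.smul_apply, ha w, smul_mul_assoc] }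
  have : v ∈ S := by
    apply indR1 S
    · intro w
      rw [ds.one_D, ds.one_D]
    · intro v hv w
      have h1 := hv w
      have h2 := D_zl ds s v w
      rw [Z1, mul_add, map_add, LinearMap.add_apply] at h2
      rw [zet, mul_add, map_add] at h1
      rw [zet] at h2 ⊢
      rw [mul_add, map_add, ds.Dxx, ds.Dxy]
      have h3 : ds.D s v (w * Xr) = ds.D s (v * X1) w + ds.D s (v * Y1) w - ds.D s v (w * Yr 1) := by
        rw [h2, ← h1]; abel
      rw [h3]
      noncomm_ring
    · intro v hv w
      have h1 := hv w
      have h2 := D_zl ds s v w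
      rw [Z1, mul_add, map_add, LinearMap.add_apply] at h2
      rw [zet, mul_add, map_add] at h1
      rw [zet] at h2 ⊢
      rw [mul_add, map_add, ds.Dyx, ds.Dyy]
      have h3 : ds.D s v (w * Xr) = ds.D s (v * X1) w + ds.D s (v * Y1) w - ds.D s v (w * Yr 1) := by
        rw [h2, ← h1]; abel
      rw [h3]
      noncomm_ring
  exact this

theorem D_yt (ds : DiamondSetup G) (s t : G) (v : A1) (w : Ar G) :
    ds.D s (v * Y1) (w * zdel t) =
      ds.D s v (w * zdel t) * (zet - zdel t) + ds.D s (v * Y1) w * zdel t := by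
  by_cases h : t = 1
  · subst h
    rw [zdel_one, ds.Dyx, zet]
    noncomm_ring
  · have e : (zdel t : Ar G) = Xr + Yr t := by simp [zdel, h]
    rw [e, mul_add, map_add, ds.Dyx, ds.Dyyt s t h, zet]
    simp only [mul_add, map_add]
    noncomm_ring

end RTM

namespace RTM

noncomputable def jinv (G : Type) [CommGroup G] : Ar G →ₐ[ℚ] A1 :=
  open scoped Classical in
  lift ℚ (fun l => match l with
    | LetR.x => X1
    | LetR.y s => if s = 1 then Y1 else 0)

theorem jm_inj : Function.Injective (jm : A1 →ₐ[ℚ] Ar G) := by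
  have : ((jinv G).comp jm) = AlgHom.id ℚ A1 := by
    apply FreeAlgebra.hom_ext
    funext l
    cases l with
    | x => change jinv G (jm X1) = X1; rw [jm_x]; simp [jinv, Xr]
    | y => change jinv G (jm Y1) = Y1; rw [jm_y]; simp [jinv, Yr]
  exact Function.LeftInverse.injective (g := jinv G) fun v => DFunLike.congr_fun this v

theorem eh_one : (eh 1 : A1 →ₐ[ℚ] Ar G) = jm := by
  apply FreeAlgebra.hom_ext
  funext l
  cases l with
  | x => change eh 1 X1 = jm X1; rw [eh_x, jm_x, zdel_one]
  | y => change eh 1 Y1 = jm Y1; rw [eh_y, jm_y, zdel_one, zet]; abel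

theorem D1_one_l (ds : DiamondSetup G) (b : A1) : ds.D1 1 b = b := by
  apply jm_inj (G := G)
  rw [ds.D1_spec, ds.one_D]

theorem D1_one_r (ds : DiamondSetup G) (a : A1) : ds.D1 a 1 = a := by
  apply jm_inj (G := G)
  rw [ds.D1_spec, map_one, D_one', eh_one]

theorem D1_zl (ds : DiamondSetup G) (a b : A1) : ds.D1 (a * Z1) b = ds.D1 a b * Z1 := by
  apply jm_inj (G := G)
  rw [ds.D1_spec, D_zl, map_mul, ds.D1_spec, jm_z]

theorem D1_zr (ds : DiamondSetup G) (a b : A1) : ds.D1 a (b * Z1) = ds.D1 a b * Z1 := by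
  apply jm_inj (G := G)
  rw [ds.D1_spec, map_mul jm, map_mul jm, ds.D1_spec, jm_z, D_zr]

theorem D1_yy (ds : DiamondSetup G) (a b : A1) : ds.D1 (a * Y1) (b * Y1) =
    ds.D1 (a * Y1) b * Y1 + ds.D1 a (b * Y1) * Y1 - ds.D1 a b * Z1 * Y1 := by
  apply jm_inj (G := G)
  have h := D_yt ds 1 1 a (jm b)
  have e : (zdel 1 : Ar G) = zet - Yr 1 := by rw [zdel_one, zet]; abel
  rw [e, mul_sub, map_sub, map_sub, D_zr, D_zr, sub_sub_cancel] at h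
  simp only [map_sub, map_add, map_mul, ds.D1_spec, jm_z, jm_y]
  rw [sub_eq_iff_eq_add] at h
  have h2 : ∀ p q r : Ar G, p = q + r → r = p - q := by
    intro p q r h; rw [h]; abel
  rw [h2 _ _ _ h]
  noncomm_ring

theorem D_assoc (ds : DiamondSetup G) (s : G) (a : A1) : ∀ (b : A1) (w : Ar G),
    ds.D s (ds.D1 a b) w = ds.D s a (ds.D s b w) := by
  let S : Submodule ℚ A1 :=
    { carrier := {a | ∀ (b : A1) (w : Ar G), ds.D s (ds.D1 a b) w = ds.D s a (ds.D s b w)}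
      zero_mem' := by intro b w; simp
      add_mem' := by
        intro p q hp hq b w
        simp only [map_add, LinearMap.add_apply, hp b w, hq b w]
      smul_mem' := by
        intro r p hp b w
        simp only [map_smul, LinearMap.smul_apply, hp b w] }
  have : a ∈ S := by
    apply indR1z S
    · intro b w
      rw [D1_one_l, ds.one_D]
    · intro a ha b w
      rw [D1_zl, D_zl, D_zl, ha b w]
    · intro a ha b
      let S2 : Submodule ℚ A1 :=
        { carrier := {b | ∀ (w : Ar G),
            ds.D s (ds.D1 (a * Y1) b) w = ds.D s (a * Y1) (ds.D s b w)}
          zero_mem' := by intro w; simp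
          add_mem' := by
            intro p q hp hq w
            simp only [map_add, LinearMap.add_apply, hp w, hq w]
          smul_mem' := by
            intro r p hp w
            simp only [map_smul, LinearMap.smul_apply, hp w] }
      have : b ∈ S2 := by
        apply indR1z S2
        · intro w
          rw [D1_one_r, ds.one_D]
        · intro b hb w
          rw [D1_zr, D_zl, D_zl, D_zr, hb w]
        · intro b hb w
          let S3 : Submodule ℚ (Ar G) :=
            LinearMap.eqLocus (ds.D s (ds.D1 (a * Y1) (b * Y1)))
              ((ds.D s (a * Y1)).comp (ds.D s (b * Y1)))
          have : w ∈ S3 := by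
            apply indR S3
            · change ds.D s (ds.D1 (a * Y1) (b * Y1)) 1 = ds.D s (a * Y1) (ds.D s (b * Y1) 1)
              have e1 := hb 1
              have e2 := ha (b * Y1) 1
              have e3 := ha b 1
              rw [D_one', D_one'] at e1 e2 e3
              rw [D_one', D_one', D1_yy]
              simp only [map_sub, map_add, map_mul, e1, e2, e3, eh_y, eh_z]
              simp only [mul_sub, map_sub, D_zr, D_yt]
              noncomm_ring
            · intro w hw
              change ds.D s (ds.D1 (a * Y1) (b * Y1)) w
                = ds.D s (a * Y1) (ds.D s (b * Y1) w) at hw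
              change ds.D s (ds.D1 (a * Y1) (b * Y1)) (w * zet)
                = ds.D s (a * Y1) (ds.D s (b * Y1) (w * zet))
              rw [D_zr, D_zr, D_zr, hw]
            · intro t w hw
              change ds.D s (ds.D1 (a * Y1) (b * Y1)) w
                = ds.D s (a * Y1) (ds.D s (b * Y1) w) at hw
              change ds.D s (ds.D1 (a * Y1) (b * Y1)) (w * zdel t)
                = ds.D s (a * Y1) (ds.D s (b * Y1) (w * zdel t))
              have e1 := hb (w * zdel t)
              have e2 := ha (b * Y1) (w * zdel t)
              have e3 := ha b (w * zdel t)
              have l1 : ds.D s (ds.D1 (a * Y1) (b * Y1)) (w * zdel t)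
                = (ds.D s (a * Y1) (ds.D s b (w * zdel t))
                  + ds.D s a (ds.D s (b * Y1) (w * zdel t))
                  - ds.D s a (ds.D s b (w * zdel t)) * zet) * (zet - zdel t)
                  + ds.D s (a * Y1) (ds.D s (b * Y1) w) * zdel t := by
                rw [← hw, D1_yy]
                simp only [map_sub, map_add, LinearMap.sub_apply, LinearMap.add_apply, D_yt,
                  D_zl, e1, e2, e3]
                noncomm_ring
              have hx := D_yt ds s t b w
              have hx2 : ds.D s (b * Y1) w * zdel t = ds.D s (b * Y1) (w * zdel t)
                - ds.D s b (w * zdel t) * zet + ds.D s b (w * zdel t) * zdel t := by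
                rw [hx]; noncomm_ring
              have hx3 := congrArg (ds.D s a) hx2
              rw [map_add, map_sub, D_zr] at hx3
              have l2 : ds.D s (a * Y1) (ds.D s (b * Y1) (w * zdel t)) =
                  ds.D s (a * Y1) (ds.D s b (w * zdel t) * (zet - zdel t))
                  + ds.D s (a * Y1) (ds.D s (b * Y1) w * zdel t) := by
                rw [← map_add, ← hx]
              rw [l1, l2, mul_sub (ds.D s b (w * zdel t)), map_sub (ds.D s (a * Y1)), D_zr,
                D_yt ds s t a (ds.D s b (w * zdel t)), D_yt ds s t a (ds.D s (b * Y1) w), hx3]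
              noncomm_ring
          exact this
      exact this
  exact this

theorem mt_ne (t : G) : (zet - zdel t : Ar G) ≠ 0 := by
  classical
  intro h
  have := congrArg (lift ℚ (fun l : LetR G => match l with
    | LetR.x => (0 : ℚ)
    | LetR.y s => if s = 1 then 1 else 0)) h
  by_cases ht : t = 1
  · subst ht
    simp [zet, zdel, Xr, Yr] at this
  · simp [zet, zdel, Xr, Yr, ht] at this

theorem cancel_mt (t : G) {a b : Ar G} (h : a * (zet - zdel t) = b * (zet - zdel t)) : a = b :=
  mul_right_cancel₀ (mt_ne t) h

section CK
open TensorProduct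
variable {H : Type} [CommRing H] [HopfAlgebra ℚ H] (C : CKSetup G H)

theorem counit_Bp (f : H) : Coalgebra.counit (R := ℚ) (C.Bp f) = 0 := by
  have h := congrArg ((Coalgebra.counit (R := ℚ) (A := H)).rTensor H) (C.Bp_cocycle f)
  rw [Coalgebra.rTensor_counit_comul, map_add, LinearMap.rTensor_tmul] at h
  have h2 : (Coalgebra.counit (R := ℚ) (A := H)).rTensor H
      ((TensorProduct.map LinearMap.id C.Bp) (Coalgebra.comul (R := ℚ) f))
      = C.Bp.lTensor ℚ ((Coalgebra.counit (R := ℚ) (A := H)).rTensor H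
        (Coalgebra.comul (R := ℚ) f)) := by
    generalize Coalgebra.comul (R := ℚ) f = q
    induction q using TensorProduct.induction_on with
    | zero => simp
    | tmul a b => simp
    | add a b ha hb => simp only [map_add, ha, hb]
  rw [h2, Coalgebra.rTensor_counit_comul, LinearMap.lTensor_tmul] at h
  have h3 := congrArg (TensorProduct.lid ℚ H) h
  rw [map_add, TensorProduct.lid_tmul, TensorProduct.lid_tmul] at h3
  have h4 := congrArg (Coalgebra.counit (R := ℚ) (A := H)) (right_eq_add.mp h3)
  simpa using h4

theorem T_zet (h : H) : C.T h (zet : Ar G) = Coalgebra.counit (R := ℚ) h • zet := by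
  let P : Submodule ℚ H :=
    { carrier := {h | C.T h (zet : Ar G) = Coalgebra.counit (R := ℚ) h • zet}
      zero_mem' := by simp
      add_mem' := by
        intro a b ha hb
        change C.T a zet = _ at ha
        change C.T b zet = _ at hb
        change C.T (a + b) zet = _
        rw [map_add, LinearMap.add_apply, ha, hb, map_add, add_smul]
      smul_mem' := by
        intro r a ha
        change C.T a zet = _ at ha
        change C.T (r • a) zet = _
        rw [map_smul, LinearMap.smul_apply, ha, map_smul, smul_eq_mul, mul_smul] }
  apply C.hgen P
  · change C.T 1 zet = _
    simp
  · intro a b ha hb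
    change C.T a zet = _ at ha
    change C.T b zet = _ at hb
    change C.T (a * b) zet = _
    rw [map_mul, Module.End.mul_apply, hb, map_smul, ha, smul_smul, Bialgebra.counit_mul, mul_comm]
  · intro a _
    change C.T (C.Bp a) zet = _
    rw [C.T_graft_z, counit_Bp, zero_smul]

theorem T_uex (h : H) (t : G) : ∃ u : Ar G,
    C.T h (zdel t) = Coalgebra.counit (R := ℚ) h • zdel t + u * (zet - zdel t) ∧
    C.T (C.Bp h) (zdel t) = Coalgebra.counit (R := ℚ) h • (zdel t * (zet - zdel t))
      + u * ((2 : ℚ) • zet - zdel t) * (zet - zdel t) := by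
  set e := Coalgebra.counit (R := ℚ) h with he
  have h0 : Coalgebra.counit (R := ℚ) (h - e • (1 : H)) = 0 := by
    simp [he]
  obtain ⟨u, hu⟩ := C.T_ends _ h0 t
  have h2 := C.T_graft _ h0 t u hu
  refine ⟨u, ?_, ?_⟩
  · rw [← hu]; simp
  · rw [← h2, map_sub, map_smul, map_sub, map_smul, LinearMap.sub_apply, LinearMap.smul_apply,
      C.T_dot_zdel]
    abel

theorem F_uex (h : H) : ∃ u : A1,
    C.F h = Coalgebra.counit (R := ℚ) h • 1 + u * Y1 ∧
    C.F (C.Bp h) = Coalgebra.counit (R := ℚ) h • Y1 + u * (Z1 + Y1) * Y1 := by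
  set e := Coalgebra.counit (R := ℚ) h with he
  have h0 : Coalgebra.counit (R := ℚ) (h - e • (1 : H)) = 0 := by
    simp [he]
  obtain ⟨u, hu⟩ := C.F_ends _ h0
  have h2 := C.F_graft _ h0 u hu
  have e2 : (X1 + (2 : ℚ) • Y1) = Z1 + Y1 := by rw [Z1, two_smul]; abel
  refine ⟨u, ?_, ?_⟩
  · rw [← hu, map_sub, map_smul, C.F_one]; abel
  · rw [← e2, ← h2, map_sub, map_smul, map_sub, map_smul, C.F_dot]
    abel

theorem T_eq (f : H) : ∀ (s : G) (w : Ar G),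
    C.T f (zdel s * w) = zdel s * C.ds.D s (C.F f) w := by
  let P : Submodule ℚ H :=
    { carrier := {f | ∀ (s : G) (w : Ar G),
        C.T f (zdel s * w) = zdel s * C.ds.D s (C.F f) w}
      zero_mem' := by intro s w; simp
      add_mem' := by
        intro a b ha hb s w
        simp only [map_add, LinearMap.add_apply, ha s w, hb s w, mul_add]
      smul_mem' := by
        intro r a ha s w
        simp only [map_smul, LinearMap.smul_apply, ha s w, mul_smul_comm] }
  apply C.hgen P
  · intro s w
    rw [map_one, C.F_one, C.ds.one_D, Module.End.one_apply]
  · intro a b ha hb s w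
    rw [map_mul C.T, Module.End.mul_apply, hb s w, ha s, C.F_mul, D_assoc]
  · intro g hg s w
    obtain ⟨v, hv1, hv2⟩ := F_uex C g
    set e := Coalgebra.counit (R := ℚ) g with he
    let R := Coalgebra.Repr.arbitrary ℚ g
    have hR := R.eq
    have hcou : ∑ i ∈ R.index, Coalgebra.counit (R := ℚ) (R.right i) • R.left i = g := by
      have h := Coalgebra.lTensor_counit_comul (R := ℚ) g
      rw [← hR, map_sum] at h
      have h2 := congrArg (TensorProduct.rid ℚ H) h
      rw [map_sum, TensorProduct.rid_tmul, one_smul] at h2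
      refine Eq.trans ?_ h2
      apply Finset.sum_congr rfl
      intro i _
      rw [LinearMap.lTensor_tmul, TensorProduct.rid_tmul]
    have cop : ∀ (w v : Ar G), (v = zet ∨ ∃ s : G, v = zdel s) → C.T g (w * v)
        = ∑ i ∈ R.index, C.T (R.left i) w * C.T (R.right i) v := by
      intro w v hv
      rw [C.T_coprod g w v hv, ← hR, map_sum]
      rfl
    have copB : ∀ (w v : Ar G), (v = zet ∨ ∃ s : G, v = zdel s) → C.T (C.Bp g) (w * v)
        = C.T (C.Bp g) w * v + ∑ i ∈ R.index, C.T (R.left i) w * C.T (C.Bp (R.right i)) v := by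
      intro w v hv
      rw [C.T_coprod _ w v hv, C.Bp_cocycle, map_add, ← hR, map_sum, map_sum]
      congr 1
      change C.T (C.Bp g) w * C.T 1 v = _
      rw [map_one, Module.End.one_apply]
    let S : Submodule ℚ (Ar G) :=
      LinearMap.eqLocus ((C.T (C.Bp g)).comp (LinearMap.mulLeft ℚ (zdel s)))
        ((LinearMap.mulLeft ℚ (zdel s)).comp (C.ds.D s (C.F (C.Bp g))))
    have : w ∈ S := by
      apply indR S
      · change C.T (C.Bp g) (zdel s * 1) = zdel s * C.ds.D s (C.F (C.Bp g)) 1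
        obtain ⟨u, hu1, hu2⟩ := T_uex C g s
        have h1 := hg s 1
        rw [mul_one, hu1, D_one', hv1] at h1
        have h2 : u * (zet - zdel s) = (zdel s * eh s v) * (zet - zdel s) := by
          rw [map_add, map_mul, map_smul, map_one, eh_y, mul_add, mul_smul_comm, mul_one] at h1
          rw [mul_assoc]
          exact add_left_cancel h1
        have h3 := cancel_mt s h2
        rw [mul_one, hu2, D_one', hv2, h3, map_add, map_smul, map_mul, map_mul, map_add, eh_y,
          eh_z, ← he, mul_add, mul_smul_comm, two_smul]
        noncomm_ring
      · intro w hw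
        change C.T (C.Bp g) (zdel s * w) = zdel s * C.ds.D s (C.F (C.Bp g)) w at hw
        change C.T (C.Bp g) (zdel s * (w * zet)) = zdel s * C.ds.D s (C.F (C.Bp g)) (w * zet)
        rw [← mul_assoc, copB _ _ (Or.inl rfl), D_zr, hw]
        simp [C.T_graft_z, mul_assoc]
      · intro t w hw
        change C.T (C.Bp g) (zdel s * w) = zdel s * C.ds.D s (C.F (C.Bp g)) w at hw
        change C.T (C.Bp g) (zdel s * (w * zdel t))
          = zdel s * C.ds.D s (C.F (C.Bp g)) (w * zdel t)
        choose u hu1 hu2 using fun i => T_uex C (R.right i) t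
        set U := ∑ i ∈ R.index, C.T (R.left i) (zdel s * w) * u i with hU
        have hsum : ∑ i ∈ R.index, Coalgebra.counit (R := ℚ) (R.right i) •
            C.T (R.left i) (zdel s * w) = C.T g (zdel s * w) := by
          conv_rhs => rw [← hcou]
          simp [LinearMap.sum_apply]
        have a1 : C.T g (zdel s * w * zdel t) = C.T g (zdel s * w) * zdel t
            + U * (zet - zdel t) := by
          rw [cop _ _ (Or.inr ⟨t, rfl⟩), ← hsum, hU, Finset.sum_mul, Finset.sum_mul,
            ← Finset.sum_add_distrib]
          apply Finset.sum_congr rfl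
          intro i _
          rw [hu1, mul_add, mul_smul_comm, smul_mul_assoc, mul_assoc]
        have a2 : C.T (C.Bp g) (zdel s * w * zdel t) = C.T (C.Bp g) (zdel s * w) * zdel t
            + (C.T g (zdel s * w) * zdel t * (zet - zdel t)
            + U * ((2 : ℚ) • zet - zdel t) * (zet - zdel t)) := by
          rw [copB _ _ (Or.inr ⟨t, rfl⟩), ← hsum, hU]
          simp only [Finset.sum_mul]
          rw [← Finset.sum_add_distrib]
          congr 1
          apply Finset.sum_congr rfl
          intro i _
          rw [hu2, mul_add, mul_smul_comm]
          simp only [smul_mul_assoc, mul_assoc]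
        have b1 := hg s (w * zdel t)
        rw [← mul_assoc, a1, hg s w, hv1] at b1
        have b2 : U * (zet - zdel t) = (zdel s * C.ds.D s v (w * zdel t)) * (zet - zdel t) := by
          simp only [map_add, map_smul, LinearMap.add_apply, LinearMap.smul_apply, C.ds.one_D,
            D_yt, mul_add, add_mul, mul_smul_comm, smul_mul_assoc] at b1
          have b3 : ∀ p q r x : Ar G, p + q + r = p + (x + q) → r = x := by
            intro p q r x h
            have : p + q + r = p + q + x := by rw [h]; abel
            exact add_left_cancel this
          rw [mul_assoc]
          apply b3 _ _ _ _ _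
          · exact e • (zdel s * (w * zdel t))
          · exact zdel s * (C.ds.D s (v * Y1) w * zdel t)
          · simp only [mul_assoc] at b1 ⊢
            exact b1
        have b4 := cancel_mt t b2
        rw [← mul_assoc, a2, hw, hg s w, b4, hv1, hv2]
        simp only [map_add, map_smul, LinearMap.add_apply, LinearMap.smul_apply, C.ds.one_D,
            D_yt, D_zl, mul_add, add_mul]
        have c1 : C.ds.D s Y1 (w * zdel t) = w * zdel t * (zet - zdel t)
            + C.ds.D s Y1 w * zdel t := by
          have := D_yt C.ds s t 1 w
          rwa [one_mul, C.ds.one_D] at this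
        rw [c1, two_smul]
        simp only [smul_add, mul_add, add_mul, mul_sub, sub_mul, mul_smul_comm, smul_mul_assoc,
          mul_assoc, smul_sub]
        abel
    exact this

end CK

end RTM

namespace RTM

section Rdef
variable (ds : DiamondSetup G) (s : G)

noncomputable def opX :
    Module.End ℚ (A1 × (Ar G →ₗ[ℚ] Ar G)) :=
  LinearMap.prod ((LinearMap.mulLeft ℚ X1).comp (LinearMap.fst ℚ _ _))
    (((LinearMap.compRight ℚ (LinearMap.mulLeft ℚ (zdel s))).comp (ds.D s)).comp
      (LinearMap.fst ℚ _ _))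

noncomputable def opZ (G : Type) [CommGroup G] :
    Module.End ℚ (A1 × (Ar G →ₗ[ℚ] Ar G)) :=
  LinearMap.prod ((LinearMap.mulLeft ℚ Z1).comp (LinearMap.fst ℚ _ _))
    ((LinearMap.compRight ℚ (LinearMap.mulLeft ℚ (zet : Ar G))).comp (LinearMap.snd ℚ _ _))

noncomputable def opA : A1 →ₐ[ℚ] Module.End ℚ (A1 × (Ar G →ₗ[ℚ] Ar G)) :=
  lift ℚ (fun l => match l with
    | LetA.x => opX ds s
    | LetA.y => opZ G - opX ds s)

/-- the auxiliary product `R_s`. -/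
noncomputable def Rs : A1 →ₗ[ℚ] Ar G →ₗ[ℚ] Ar G :=
  (LinearMap.snd ℚ A1 (Ar G →ₗ[ℚ] Ar G)).comp
    ((LinearMap.applyₗ ((1 : A1), (0 : Ar G →ₗ[ℚ] Ar G))).comp (opA ds s).toLinearMap)

theorem opA_x : opA ds s X1 = opX ds s := by simp [opA, X1]
theorem opA_z : opA ds s Z1 = opZ G := by
  simp [opA, Z1, X1, Y1]
  abel

theorem opA_fst (v : A1) : (opA ds s v (1, 0)).1 = v := by
  let S : Submodule ℚ A1 := LinearMap.eqLocus
    ((LinearMap.fst ℚ A1 (Ar G →ₗ[ℚ] Ar G)).comp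
      ((LinearMap.applyₗ ((1 : A1), (0 : Ar G →ₗ[ℚ] Ar G))).comp (opA ds s).toLinearMap))
    LinearMap.id
  have : v ∈ S := by
    apply indL1z S
    · change (opA ds s 1 (1, 0)).1 = 1
      simp
    · intro v hv
      change (opA ds s v (1, 0)).1 = v at hv
      change (opA ds s (X1 * v) (1, 0)).1 = X1 * v
      rw [map_mul, opA_x, Module.End.mul_apply]
      change X1 * (opA ds s v (1, 0)).1 = _
      rw [hv]
    · intro v hv
      change (opA ds s v (1, 0)).1 = v at hv
      change (opA ds s (Z1 * v) (1, 0)).1 = Z1 * v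
      rw [map_mul, opA_z, Module.End.mul_apply]
      change Z1 * (opA ds s v (1, 0)).1 = _
      rw [hv]
  exact this

theorem R_one (w : Ar G) : Rs ds s 1 w = 0 := by
  change (opA ds s 1 (1, 0)).2 w = 0
  simp

theorem R_x (v : A1) (w : Ar G) : Rs ds s (X1 * v) w = zdel s * ds.D s v w := by
  change (opA ds s (X1 * v) (1, 0)).2 w = _
  rw [map_mul, opA_x, Module.End.mul_apply]
  change zdel s * ds.D s (opA ds s v (1, 0)).1 w = _
  rw [opA_fst]

theorem R_z (v : A1) (w : Ar G) : Rs ds s (Z1 * v) w = zet * Rs ds s v w := by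
  change (opA ds s (Z1 * v) (1, 0)).2 w = _
  rw [map_mul, opA_z, Module.End.mul_apply]
  rfl

theorem R_y1 (w : Ar G) : Rs ds s Y1 w = - (zdel s * w) := by
  have e : Y1 = Z1 * 1 - X1 * 1 := by rw [Z1]; noncomm_ring
  rw [e, map_sub, LinearMap.sub_apply, R_z, R_x, R_one, ds.one_D]
  simp

theorem R_zl (v : A1) (w : Ar G) : Rs ds s (v * Z1) w = Rs ds s v w * zet := by
  let S : Submodule ℚ A1 := LinearMap.eqLocus
    (((Rs ds s).flip w).comp (LinearMap.mulRight ℚ Z1))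
    ((LinearMap.mulRight ℚ zet).comp ((Rs ds s).flip w))
  have : v ∈ S := by
    apply indL1z S
    · change Rs ds s (1 * Z1) w = Rs ds s 1 w * zet
      have := R_z ds s 1 w
      rw [mul_one] at this
      rw [one_mul, this, R_one]; simp
    · intro v hv
      change Rs ds s (v * Z1) w = Rs ds s v w * zet at hv
      change Rs ds s (X1 * v * Z1) w = Rs ds s (X1 * v) w * zet
      rw [mul_assoc, R_x, R_x, D_zl, mul_assoc]
    · intro v hv
      change Rs ds s (v * Z1) w = Rs ds s v w * zet at hv
      change Rs ds s (Z1 * v * Z1) w = Rs ds s (Z1 * v) w * zet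
      rw [mul_assoc, R_z, R_z, hv, mul_assoc]
  exact this

theorem R_zr (v : A1) (w : Ar G) : Rs ds s v (w * zet) = Rs ds s v w * zet := by
  let S : Submodule ℚ A1 := LinearMap.eqLocus
    ((Rs ds s).flip (w * zet))
    ((LinearMap.mulRight ℚ zet).comp ((Rs ds s).flip w))
  have : v ∈ S := by
    apply indL1z S
    · change Rs ds s 1 (w * zet) = Rs ds s 1 w * zet
      rw [R_one, R_one]; simp
    · intro v hv
      change Rs ds s (X1 * v) (w * zet) = Rs ds s (X1 * v) w * zet
      rw [R_x, R_x, D_zr, mul_assoc]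
    · intro v hv
      change Rs ds s v (w * zet) = Rs ds s v w * zet at hv
      change Rs ds s (Z1 * v) (w * zet) = Rs ds s (Z1 * v) w * zet
      rw [R_z, R_z, hv, mul_assoc]
  exact this

theorem R_yt (t : G) (v : A1) (w : Ar G) : Rs ds s (v * Y1) (w * zdel t) =
    Rs ds s v (w * zdel t) * (zet - zdel t) + Rs ds s (v * Y1) w * zdel t := by
  let S : Submodule ℚ A1 := LinearMap.eqLocus
    (((Rs ds s).flip (w * zdel t)).comp (LinearMap.mulRight ℚ Y1))
    ((LinearMap.mulRight ℚ (zet - zdel t)).comp ((Rs ds s).flip (w * zdel t)) +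
      (LinearMap.mulRight ℚ (zdel t)).comp (((Rs ds s).flip w).comp (LinearMap.mulRight ℚ Y1)))
  have : v ∈ S := by
    apply indL1z S
    · change Rs ds s (1 * Y1) (w * zdel t) =
        Rs ds s 1 (w * zdel t) * (zet - zdel t) + Rs ds s (1 * Y1) w * zdel t
      rw [R_one, one_mul, R_y1, R_y1]; noncomm_ring
    · intro v hv
      change Rs ds s (X1 * v * Y1) (w * zdel t) =
        Rs ds s (X1 * v) (w * zdel t) * (zet - zdel t) + Rs ds s (X1 * v * Y1) w * zdel t
      rw [mul_assoc X1, R_x, R_x, R_x, D_yt]; noncomm_ring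
    · intro v hv
      change Rs ds s (v * Y1) (w * zdel t) =
        Rs ds s v (w * zdel t) * (zet - zdel t) + Rs ds s (v * Y1) w * zdel t at hv
      change Rs ds s (Z1 * v * Y1) (w * zdel t) =
        Rs ds s (Z1 * v) (w * zdel t) * (zet - zdel t) + Rs ds s (Z1 * v * Y1) w * zdel t
      rw [mul_assoc Z1, R_z, R_z, R_z, hv]; noncomm_ring
  exact this

end Rdef

theorem uniq (Θ : A1 →ₗ[ℚ] Ar G →ₗ[ℚ] Ar G)
    (h1 : ∀ v w, Θ (v * Z1) w = Θ v w * zet) (h2 : ∀ v w, Θ v (w * zet) = Θ v w * zet)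
    (h3 : ∀ t v w, Θ (v * Y1) (w * zdel t) =
      Θ v (w * zdel t) * (zet - zdel t) + Θ (v * Y1) w * zdel t)
    (h4 : ∀ w, Θ 1 w = 0) (h5 : ∀ v, Θ v 1 = 0) (v : A1) : ∀ w, Θ v w = 0 := by
  have : v ∈ LinearMap.ker Θ := by
    apply indR1z
    · exact LinearMap.ext h4
    · intro v hv
      apply LinearMap.ext
      intro w
      rw [LinearMap.mem_ker] at hv
      rw [h1, hv]; simp
    · intro v hv
      apply LinearMap.ext
      intro w
      rw [LinearMap.mem_ker] at hv
      have : w ∈ LinearMap.ker (Θ (v * Y1)) := by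
        apply indR
        · exact h5 _
        · intro w hw
          rw [LinearMap.mem_ker] at hw
          change Θ (v * Y1) (w * zet) = 0
          rw [h2, hw, zero_mul]
        · intro t w hw
          rw [LinearMap.mem_ker] at hw
          change Θ (v * Y1) (w * zdel t) = 0
          rw [h3, hw, hv]; simp
      exact this
  intro w
  rw [LinearMap.mem_ker.mp this]; rfl

noncomputable def qh (G : Type) [CommGroup G] : A1 →ₐ[ℚ] Ar G :=
  lift ℚ (fun l => match l with
    | LetA.x => 0
    | LetA.y => zet)

theorem qh_x : qh G X1 = 0 := by simp [qh, X1]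
theorem qh_y : qh G Y1 = zet := by simp [qh, Y1]
theorem qh_z : qh G Z1 = zet := by simp [Z1, qh_x, qh_y]

theorem qh_comm (v : A1) : qh G v * zet = zet * qh G v := by
  let S : Submodule ℚ A1 := LinearMap.eqLocus
    ((LinearMap.mulRight ℚ zet).comp (qh G).toLinearMap)
    ((LinearMap.mulLeft ℚ zet).comp (qh G).toLinearMap)
  have : v ∈ S := by
    apply indL1z S
    · change qh G 1 * zet = zet * qh G 1
      simp
    · intro v hv
      change qh G (X1 * v) * zet = zet * qh G (X1 * v)
      simp [qh_x]
    · intro v hv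
      change qh G v * zet = zet * qh G v at hv
      change qh G (Z1 * v) * zet = zet * qh G (Z1 * v)
      rw [map_mul, qh_z, mul_assoc, hv]
  exact this

theorem eh_sub_R (ds : DiamondSetup G) (s : G) (v : A1) : eh s v - Rs ds s v 1 = qh G v := by
  let S : Submodule ℚ A1 := LinearMap.eqLocus
    ((eh s).toLinearMap - (Rs ds s).flip 1) (qh G).toLinearMap
  have : v ∈ S := by
    apply indL1z S
    · change eh s 1 - Rs ds s 1 1 = qh G 1
      rw [R_one]; simp
    · intro v hv
      change eh s (X1 * v) - Rs ds s (X1 * v) 1 = qh G (X1 * v)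
      rw [R_x, D_one', map_mul, eh_x, map_mul, qh_x]; simp
    · intro v hv
      change eh s v - Rs ds s v 1 = qh G v at hv
      change eh s (Z1 * v) - Rs ds s (Z1 * v) 1 = qh G (Z1 * v)
      rw [R_z, map_mul, eh_z, map_mul, qh_z, ← hv, mul_sub]
  exact this

theorem L3 (ds : DiamondSetup G) (s : G) (v : A1) (w : Ar G) :
    ds.D s v (zet * w) - Rs ds s v (zet * w) = zet * (ds.D s v w - Rs ds s v w) := by
  let Θ : A1 →ₗ[ℚ] Ar G →ₗ[ℚ] Ar G := LinearMap.mk₂ ℚ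
    (fun v w => ds.D s v (zet * w) - Rs ds s v (zet * w) - zet * (ds.D s v w - Rs ds s v w))
    (by intro a b w; simp only [map_add, LinearMap.add_apply]; noncomm_ring)
    (by intro r a w; simp only [map_smul, LinearMap.smul_apply, ← smul_sub, mul_smul_comm])
    (by intro a w w'; simp only [map_add, mul_add]; noncomm_ring)
    (by intro r a w; simp only [map_smul, ← smul_sub, mul_smul_comm])
  have := uniq Θ (v := v) ?_ ?_ ?_ ?_ ?_ w
  · exact sub_eq_zero.mp this
  · intro v w
    simp only [Θ, LinearMap.mk₂_apply, D_zl, R_zl]; noncomm_ring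
  · intro v w
    simp only [Θ, LinearMap.mk₂_apply, ← mul_assoc, D_zr, R_zr]; noncomm_ring
  · intro t v w
    simp only [Θ, LinearMap.mk₂_apply, ← mul_assoc, D_yt, R_yt]; noncomm_ring
  · intro w
    simp only [Θ, LinearMap.mk₂_apply, ds.one_D, R_one]; simp
  · intro v
    have e : (zet : Ar G) * 1 = 1 * zet := by simp
    simp only [Θ, LinearMap.mk₂_apply, D_one', e, D_zr, R_zr]
    rw [eh_sub_R, ← sub_mul, eh_sub_R, qh_comm, sub_self]

theorem L4 (ds : DiamondSetup G) (s t : G) (v : A1) (w : Ar G) :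
    ds.D s v (zdel t * w) = Rs ds s v (zdel t * w) - Rs ds t (Y1 * v) w := by
  let Θ : A1 →ₗ[ℚ] Ar G →ₗ[ℚ] Ar G := LinearMap.mk₂ ℚ
    (fun v w => ds.D s v (zdel t * w) - Rs ds s v (zdel t * w) + Rs ds t (Y1 * v) w)
    (by intro a b w; simp only [map_add, LinearMap.add_apply, mul_add]; abel)
    (by intro r a w; simp only [map_smul, LinearMap.smul_apply, mul_smul_comm, smul_sub, smul_add])
    (by intro a w w'; simp only [map_add, mul_add]; abel)
    (by intro r a w; simp only [map_smul, mul_smul_comm, smul_sub, smul_add])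
  have := uniq Θ (v := v) ?_ ?_ ?_ ?_ ?_ w
  · have h : ds.D s v (zdel t * w) - Rs ds s v (zdel t * w) + Rs ds t (Y1 * v) w = 0 := this
    have : ds.D s v (zdel t * w) = (ds.D s v (zdel t * w) - Rs ds s v (zdel t * w)
      + Rs ds t (Y1 * v) w) + (Rs ds s v (zdel t * w) - Rs ds t (Y1 * v) w) := by abel
    rw [this, h, zero_add]
  · intro v w
    simp only [Θ, LinearMap.mk₂_apply, ← mul_assoc, D_zl, R_zl]; noncomm_ring
  · intro v w
    simp only [Θ, LinearMap.mk₂_apply, ← mul_assoc, D_zr, R_zr]; noncomm_ring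
  · intro t v w
    simp only [Θ, LinearMap.mk₂_apply, ← mul_assoc, D_yt, R_yt]; noncomm_ring
  · intro w
    simp only [Θ, LinearMap.mk₂_apply, ds.one_D, R_one, mul_one, R_y1]; simp
  · intro v
    have : v ∈ LinearMap.ker (Θ.flip 1) := by
      apply indR1z
      · change ds.D s 1 (zdel t * 1) - Rs ds s 1 (zdel t * 1) + Rs ds t (Y1 * 1) 1 = 0
        rw [ds.one_D, R_one, mul_one, mul_one, R_y1]; simp
      · intro v hv
        change ds.D s v (zdel t * 1) - Rs ds s v (zdel t * 1) + Rs ds t (Y1 * v) 1 = 0 at hv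
        change ds.D s (v * Z1) (zdel t * 1) - Rs ds s (v * Z1) (zdel t * 1)
          + Rs ds t (Y1 * (v * Z1)) 1 = 0
        rw [← mul_assoc, D_zl, R_zl, R_zl, ← sub_mul, ← add_mul, hv, zero_mul]
      · intro v hv
        change ds.D s v (zdel t * 1) - Rs ds s v (zdel t * 1) + Rs ds t (Y1 * v) 1 = 0 at hv
        change ds.D s (v * Y1) (zdel t * 1) - Rs ds s (v * Y1) (zdel t * 1)
          + Rs ds t (Y1 * (v * Y1)) 1 = 0
        have a1 := D_yt ds s t v 1
        have a2 := R_yt ds s t v 1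
        rw [one_mul] at a1 a2
        rw [mul_one] at hv
        rw [mul_one, a1, a2, D_one']
        have b1 := eh_sub_R ds s (v * Y1)
        have b2 := eh_sub_R ds t (Y1 * v * Y1)
        have b3 := eh_sub_R ds t (Y1 * v)
        have c1 : eh s (v * Y1) = qh G (v * Y1) + Rs ds s (v * Y1) 1 := by rw [← b1]; abel
        have c2 : Rs ds t (Y1 * (v * Y1)) 1 = eh t (Y1 * v) * (zet - zdel t)
            - qh G (Y1 * v * Y1) := by
          rw [← b2, map_mul (eh t) (Y1 * v), eh_y, ← mul_assoc]; abel
        have c3 : eh t (Y1 * v) = qh G (Y1 * v) + Rs ds t (Y1 * v) 1 := by rw [← b3]; abel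
        have c4 : ds.D s v (zdel t) = Rs ds s v (zdel t) - Rs ds t (Y1 * v) 1 := by
          have : ds.D s v (zdel t) = (ds.D s v (zdel t) - Rs ds s v (zdel t)
            + Rs ds t (Y1 * v) 1) + (Rs ds s v (zdel t) - Rs ds t (Y1 * v) 1) := by abel
          rw [this, hv, zero_add]
        rw [c1, c2, c3, c4]
        simp only [map_mul, qh_y]
        rw [← qh_comm]
        noncomm_ring
    exact this

/-- constant term. -/
noncomputable def ep (G : Type) [CommGroup G] : Ar G →ₐ[ℚ] ℚ := lift ℚ (fun _ => 0)

theorem ep_X : ep G Xr = 0 := by simp [ep, Xr]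
theorem ep_Y (t : G) : ep G (Yr t) = 0 := by simp [ep, Yr]
theorem ep_z : ep G zet = 0 := by simp [zet, ep_X, ep_Y]
theorem ep_zt (t : G) : ep G (zdel t) = 0 := by
  rw [zdel]; split_ifs <;> simp [ep_X, ep_Y]

theorem ep_D (ds : DiamondSetup G) (s : G) (v : A1) (w : Ar G) :
    ep G (ds.D s (v * Y1) w) = 0 := by
  have : w ∈ LinearMap.ker ((ep G).toLinearMap.comp (ds.D s (v * Y1))) := by
    apply indR
    · change ep G (ds.D s (v * Y1) 1) = 0
      rw [D_one']; simp [eh_y, ep_z, ep_zt]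
    · intro w _
      change ep G (ds.D s (v * Y1) (w * zet)) = 0
      rw [D_zr]; simp [ep_z]
    · intro t w _
      change ep G (ds.D s (v * Y1) (w * zdel t)) = 0
      rw [D_yt]; simp [ep_z, ep_zt]
  exact this

theorem ep_R (ds : DiamondSetup G) (s : G) (v : A1) (w : Ar G) :
    ep G (Rs ds s v w) = 0 := by
  have : v ∈ LinearMap.ker ((ep G).toLinearMap.comp ((Rs ds s).flip w)) := by
    apply indL1z
    · change ep G (Rs ds s 1 w) = 0
      rw [R_one]; simp
    · intro v _
      change ep G (Rs ds s (X1 * v) w) = 0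
      rw [R_x]; simp [ep_zt]
    · intro v _
      change ep G (Rs ds s (Z1 * v) w) = 0
      rw [R_z]; simp [ep_z]
  exact this

/-- span of the words ending in some `y_t`. -/
noncomputable def Ey (G : Type) [CommGroup G] : Submodule ℚ (Ar G) :=
  Submodule.span ℚ {a | ∃ (b : Ar G) (t : G), a = b * Yr t}

theorem Ey_mt (b : Ar G) (t : G) : b * (zet - zdel t) ∈ Ey G := by
  by_cases h : t = 1
  · subst h
    rw [zdel_one, zet, add_sub_cancel_left]
    exact Submodule.subset_span ⟨b, 1, rfl⟩
  · have : (zet - zdel t : Ar G) = Yr 1 - Yr t := by simp [zet, zdel, h]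
    rw [this, mul_sub]
    exact Submodule.sub_mem _ (Submodule.subset_span ⟨b, 1, rfl⟩)
      (Submodule.subset_span ⟨b, t, rfl⟩)

theorem Ey_mul (a b : Ar G) (hb : b ∈ Ey G) : a * b ∈ Ey G := by
  induction hb using Submodule.span_induction with
  | mem w h =>
    obtain ⟨c, t, rfl⟩ := h
    exact Submodule.subset_span ⟨a * c, t, by rw [mul_assoc]⟩
  | zero => simp
  | add x y _ _ hx hy => rw [mul_add]; exact Submodule.add_mem _ hx hy
  | smul r x _ hx => rw [mul_smul_comm]; exact Submodule.smul_mem _ _ hx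

theorem eh_Ey (s : G) (v : A1) : eh s (v * Y1) ∈ Ey G := by
  rw [map_mul, eh_y]
  exact Ey_mt _ _

theorem D_mt (ds : DiamondSetup G) (s t : G) (v : A1) (w : Ar G) :
    ds.D s (v * Y1) (w * (zet - zdel t)) =
      (ds.D s (v * Y1) w - ds.D s v (w * zdel t)) * (zet - zdel t) := by
  rw [mul_sub, map_sub, D_zr, D_yt]; noncomm_ring

theorem D_Ey (ds : DiamondSetup G) (s : G) (v : A1) (w : Ar G) (hw : w ∈ Ey G) :
    ds.D s (v * Y1) w ∈ Ey G := by
  induction hw using Submodule.span_induction with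
  | mem w h =>
    obtain ⟨c, t, rfl⟩ := h
    have key : ∀ t, ds.D s (v * Y1) (c * (zet - zdel t)) ∈ Ey G := by
      intro t; rw [D_mt]; exact Ey_mt _ _
    by_cases ht : t = 1
    · subst ht
      have := key 1
      rwa [zdel_one, zet, add_sub_cancel_left] at this
    · have e : (Yr t : Ar G) = (zet - zdel 1) - (zet - zdel t) := by
        rw [zdel_one]; simp [zdel, ht]
      rw [e, mul_sub, map_sub]
      exact Submodule.sub_mem _ (key 1) (key t)
  | zero => simp
  | add x y _ _ hx hy => rw [map_add]; exact Submodule.add_mem _ hx hy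
  | smul r x _ hx => rw [map_smul]; exact Submodule.smul_mem _ _ hx

theorem ep_Ey (w : Ar G) (hw : w ∈ Ey G) : ep G w = 0 := by
  induction hw using Submodule.span_induction with
  | mem w h =>
    obtain ⟨c, t, rfl⟩ := h
    simp [ep_Y]
  | zero => simp
  | add x y _ _ hx hy => rw [map_add, hx, hy, add_zero]
  | smul r x _ hx => rw [map_smul, hx, smul_zero]

theorem wAdm_eq (l : ℕ) (k : Fin l → ℕ) (s : Fin l → G) :
    wAdm l k s = wordP (List.ofFn fun i => (k i - 1, s i)) := by
  rw [wAdm, wordP, List.map_ofFn]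
  rfl

theorem wordP_cons (p : ℕ × G) (L : List (ℕ × G)) :
    wordP (p :: L) = Xr ^ p.1 * Yr p.2 * wordP L := by
  simp [wordP]

theorem wordP_mem (p : ℕ × G) (L : List (ℕ × G)) (h : 1 ≤ p.1 ∨ p.2 ≠ 1) :
    wordP (p :: L) ∈ A0plus G := by
  apply Submodule.subset_span
  refine ⟨(p :: L).length, by simp, fun i => ((p :: L).get i).1 + 1,
    fun i => ((p :: L).get i).2, ?_, ?_, ?_⟩
  · intro i; simp
  · simpa using h
  · rw [wAdm_eq]
    congr 1
    simp only [Nat.add_sub_cancel]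
    exact (List.ofFn_get _).symm

theorem Ey_span (w : Ar G) (hw : w ∈ Ey G) :
    w ∈ Submodule.span ℚ {a : Ar G | ∃ p L, a = wordP (p :: L)} := by
  induction hw using Submodule.span_induction with
  | mem w h =>
    obtain ⟨c, t, rfl⟩ := h
    let T := Submodule.span ℚ {a : Ar G | ∃ p L, a = wordP (p :: L)}
    have key : ∀ c : Ar G, ∀ w ∈ T, c * w ∈ T := by
      have hgen : ∀ c : Ar G, (∀ p L, c * wordP (p :: L) ∈ T) → ∀ w ∈ T, c * w ∈ T := by
        intro c hc w hw
        induction hw using Submodule.span_induction with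
        | mem w h => obtain ⟨p, L, rfl⟩ := h; exact hc p L
        | zero => simp
        | add x y _ _ hx hy => rw [mul_add]; exact Submodule.add_mem _ hx hy
        | smul r x _ hx => rw [mul_smul_comm]; exact Submodule.smul_mem _ _ hx
      intro c
      induction c using FreeAlgebra.induction with
      | grade0 r => intro w hw; rw [← Algebra.smul_def]; exact T.smul_mem _ hw
      | grade1 l =>
        apply hgen
        intro p L
        apply Submodule.subset_span
        cases l with
        | x =>
          refine ⟨(p.1 + 1, p.2), L, ?_⟩
          rw [wordP_cons, wordP_cons]
          change Xr * _ = _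
          simp [pow_succ', mul_assoc]
        | y t =>
          refine ⟨(0, t), p :: L, ?_⟩
          rw [wordP_cons (0, t)]
          change Yr t * _ = _
          simp
      | mul a b ha hb => intro w hw; rw [mul_assoc]; exact ha _ (hb _ hw)
      | add a b ha hb => intro w hw; rw [add_mul]; exact T.add_mem (ha _ hw) (hb _ hw)
    apply key
    apply Submodule.subset_span
    exact ⟨(0, t), [], by simp [wordP]⟩
  | zero => simp
  | add x y _ _ hx hy => exact Submodule.add_mem _ hx hy
  | smul r x _ hx => exact Submodule.smul_mem _ _ hx

theorem zdel_Ey (s : G) (w : Ar G) (hw : w ∈ Ey G) : zdel s * w ∈ A0plus G := by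
  have h := Ey_span w hw
  clear hw
  induction h using Submodule.span_induction with
  | mem w h =>
    obtain ⟨p, L, rfl⟩ := h
    have hx : (Xr : Ar G) * wordP (p :: L) ∈ A0plus G := by
      have := wordP_mem (p.1 + 1, p.2) L (by simp)
      rw [wordP_cons] at this ⊢
      simpa [pow_succ', mul_assoc] using this
    by_cases hs : s = 1
    · subst hs; rwa [zdel_one]
    · have hy : (Yr s : Ar G) * wordP (p :: L) ∈ A0plus G := by
        have := wordP_mem (0, s) (p :: L) (by simp [hs])
        rw [wordP_cons] at this
        simpa using this
      have e : (zdel s : Ar G) = Xr + Yr s := by simp [zdel, hs]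
      rw [e, add_mul]
      exact Submodule.add_mem _ hx hy
  | zero => simp
  | add x y _ _ hx hy => rw [mul_add]; exact Submodule.add_mem _ hx hy
  | smul r x _ hx => rw [mul_smul_comm]; exact Submodule.smul_mem _ _ hx

theorem wordP_Ey (p : ℕ × G) (L : List (ℕ × G)) : wordP (p :: L) ∈ Ey G := by
  induction L generalizing p with
  | nil =>
    apply Submodule.subset_span
    exact ⟨Xr ^ p.1, p.2, by simp [wordP]⟩
  | cons q L ih =>
    rw [wordP_cons]
    exact Ey_mul _ _ (ih q)

theorem A0_le (S : Submodule ℚ (Ar G)) (h1 : ∀ s, ∀ w ∈ Ey G, zdel s * w ∈ S)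
    (h2 : ∀ s : G, s ≠ 1 → Yr s ∈ S) : A0plus G ≤ S := by
  apply Submodule.span_le.mpr
  rintro a ⟨l, hl, k, s, hk, hks, rfl⟩
  rw [wAdm_eq]
  obtain ⟨n, rfl⟩ : ∃ n, l = n + 1 := ⟨l - 1, by omega⟩
  rw [List.ofFn_succ, wordP_cons]
  have hx : ∀ w ∈ Ey G, Xr * w ∈ S := by
    intro w hw; have := h1 1 w hw; rwa [zdel_one] at this
  generalize (List.ofFn fun i : Fin n => (k i.succ - 1, s i.succ)) = L
  change 2 ≤ k 0 ∨ s 0 ≠ 1 at hks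
  change Xr ^ (k 0 - 1) * Yr (s 0) * wordP L ∈ S
  by_cases hk2 : 2 ≤ k 0
  · obtain ⟨m, hm⟩ : ∃ m, k 0 - 1 = m + 1 := ⟨k 0 - 2, by omega⟩
    rw [hm, pow_succ', mul_assoc, mul_assoc]
    apply hx
    have := wordP_Ey (m, s 0) L
    rw [wordP_cons] at this
    simpa [mul_assoc] using this
  · have hs : s 0 ≠ 1 := by tauto
    have hk1 : k 0 - 1 = 0 := by omega
    rw [hk1, pow_zero, one_mul]
    cases L with
    | nil => simpa [wordP] using h2 _ hs
    | cons q L =>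
      have e : (Yr (s 0) : Ar G) = zdel (s 0) - Xr := by simp [zdel, hs]
      rw [e, sub_mul]
      exact S.sub_mem (h1 _ _ (wordP_Ey q L)) (hx _ (wordP_Ey q L))

end RTM

namespace RTM
section Ana
open MeasureTheory Set Filter Topology

/-- Lebesgue measure on `(0,1)`. -/
noncomputable def mu : Measure ℝ := volume.restrict (Ioo (0 : ℝ) 1)

instance : IsFiniteMeasure mu := by
  unfold mu; infer_instance

theorem ae_mu {P : ℝ → Prop} (h : ∀ v ∈ Ioo (0 : ℝ) 1, P v) : ∀ᵐ v ∂mu, P v :=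
  (ae_restrict_iff' measurableSet_Ioo).mpr (ae_of_all _ h)

noncomputable def gop : Bool → ℝ → ℝ → ℝ
  | true, q, v => q + (1 - q) * v
  | false, q, v => q * v

noncomputable def hop : Bool → ℝ → ℝ → ℝ
  | true, q, v => q / (q + (1 - q) * v)
  | false, _, v => 1 / v

/-- the dual kernel operators. -/
noncomputable def Op (b : Bool) (φ : ℝ → ℂ) (q : ℝ) : ℂ :=
  ∫ v, φ (gop b q v) * (hop b q v : ℂ) ∂mu

noncomputable def J : List Bool → (ℝ → ℂ) → ℂ
  | [], φ => - ∫ p, φ p * ((1 / p : ℝ) : ℂ) ∂mu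
  | b :: l, φ => J l (Op b φ)

def Cl (φ : ℝ → ℂ) (C : ℝ) : Prop :=
  Measurable φ ∧ ∀ p ∈ Ioo (0 : ℝ) 1, ‖φ p‖ ≤ C * √p

theorem isq_int : Integrable (fun v : ℝ => 1 / √v) mu := by
  have h := (intervalIntegral.intervalIntegrable_rpow' (a := 0) (b := 1) (r := -(1 / 2))
    (by norm_num)).1
  have h2 : IntegrableOn (fun v : ℝ => v ^ (-(1 / 2) : ℝ)) (Ioo 0 1) :=
    h.mono_set Ioo_subset_Ioc_self
  refine Integrable.congr h2 ?_
  apply ae_mu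
  intro v hv
  simp only
  rw [Real.rpow_neg hv.1.le, Real.sqrt_eq_rpow, one_div, one_div]

noncomputable def I0 : ℝ := ∫ v, 1 / √v ∂mu

theorem I0_nonneg : 0 ≤ I0 := integral_nonneg fun v => by positivity

theorem gop_mem (b : Bool) {q v : ℝ} (hq : q ∈ Ioo (0 : ℝ) 1) (hv : v ∈ Ioo (0 : ℝ) 1) :
    gop b q v ∈ Ioo (0 : ℝ) 1 := by
  obtain ⟨h1, h2⟩ := hq
  obtain ⟨h3, h4⟩ := hv
  cases b
  · exact ⟨mul_pos h1 h3, by simp only [gop]; nlinarith⟩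
  · constructor <;> simp only [gop] <;> nlinarith

theorem hop_nonneg (b : Bool) {q v : ℝ} (hq : q ∈ Ioo (0 : ℝ) 1) (hv : v ∈ Ioo (0 : ℝ) 1) :
    0 ≤ hop b q v := by
  cases b
  · simp only [hop]; have := hv.1; positivity
  · have : 0 < q + (1 - q) * v := (gop_mem true hq hv).1
    have := hq.1
    simp only [hop]; positivity

theorem hop_bound (b : Bool) {q v : ℝ} (hq : q ∈ Ioo (0 : ℝ) 1) (hv : v ∈ Ioo (0 : ℝ) 1) :
    √(gop b q v) * hop b q v ≤ √q * (1 / √v) := by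
  have hv0 := Real.sqrt_pos.mpr hv.1
  have hq0 := Real.sqrt_pos.mpr hq.1
  cases b
  · simp only [gop, hop]
    rw [Real.sqrt_mul hq.1.le]
    apply le_of_eq
    field_simp
    rw [Real.sq_sqrt hv.1.le, div_self hv.1.ne']
  · have hg : 0 < q + (1 - q) * v := (gop_mem true hq hv).1
    simp only [gop, hop]
    have hg0 := Real.sqrt_pos.mpr hg
    have e : √(q + (1 - q) * v) * (q / (q + (1 - q) * v)) = q / √(q + (1 - q) * v) := by
      field_simp
      rw [Real.sq_sqrt hg.le]
    rw [e]
    have h1 : √q ≤ √(q + (1 - q) * v) := by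
      apply Real.sqrt_le_sqrt
      have : 0 ≤ (1 - q) * v := mul_nonneg (by linarith [hq.2]) hv.1.le
      linarith
    have h2 : q / √(q + (1 - q) * v) ≤ √q := by
      rw [div_le_iff₀ hg0]
      calc q = √q * √q := (Real.mul_self_sqrt hq.1.le).symm
        _ ≤ _ := by gcongr
    have h3 : (1 : ℝ) ≤ 1 / √v := by
      rw [le_div_iff₀ hv0, one_mul]
      exact Real.sqrt_le_one.mpr hv.2.le
    calc _ ≤ √q * 1 := by rw [mul_one]; exact h2
      _ ≤ _ := by gcongr

theorem meas_gop (b : Bool) : Measurable (Function.uncurry (gop b)) := by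
  cases b
  · change Measurable (fun z : ℝ × ℝ => z.1 * z.2)
    fun_prop
  · change Measurable (fun z : ℝ × ℝ => z.1 + (1 - z.1) * z.2)
    fun_prop

theorem meas_hop (b : Bool) : Measurable (Function.uncurry (hop b)) := by
  cases b
  · change Measurable (fun z : ℝ × ℝ => 1 / z.2)
    fun_prop
  · change Measurable (fun z : ℝ × ℝ => z.1 / (z.1 + (1 - z.1) * z.2))
    fun_prop

theorem Op_pt (b : Bool) {φ : ℝ → ℂ} {C : ℝ} (hφ : ∀ p ∈ Ioo (0 : ℝ) 1, ‖φ p‖ ≤ C * √p)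
    {q v : ℝ} (hq : q ∈ Ioo (0 : ℝ) 1)
    (hv : v ∈ Ioo (0 : ℝ) 1) : ‖φ (gop b q v) * (hop b q v : ℂ)‖ ≤ C * √q * (1 / √v) := by
  have hC : 0 ≤ C := by
    have := (norm_nonneg _).trans (hφ q hq)
    exact nonneg_of_mul_nonneg_left this (Real.sqrt_pos.mpr hq.1)
  rw [norm_mul, Complex.norm_real, Real.norm_of_nonneg (hop_nonneg b hq hv)]
  calc _ ≤ (C * √(gop b q v)) * hop b q v := by
        gcongr
        · exact hop_nonneg b hq hv
        · exact hφ _ (gop_mem b hq hv)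
    _ = C * (√(gop b q v) * hop b q v) := by ring
    _ ≤ C * (√q * (1 / √v)) := by gcongr C * ?_; exact hop_bound b hq hv
    _ = _ := by ring

theorem Op_meas_q (b : Bool) {φ : ℝ → ℂ} (hφ : Measurable φ) (q : ℝ) :
    Measurable fun v => φ (gop b q v) * (hop b q v : ℂ) := by
  apply Measurable.mul
  · exact hφ.comp ((meas_gop b).comp measurable_prodMk_left)
  · exact Complex.measurable_ofReal.comp ((meas_hop b).comp measurable_prodMk_left)

theorem Op_int (b : Bool) {φ : ℝ → ℂ} {C : ℝ} (hφ : Cl φ C) {q : ℝ} (hq : q ∈ Ioo (0 : ℝ) 1) :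
    Integrable (fun v => φ (gop b q v) * (hop b q v : ℂ)) mu := by
  refine Integrable.mono' (isq_int.const_mul (C * √q))
    (Op_meas_q b hφ.1 q).aestronglyMeasurable ?_
  exact ae_mu fun v hv => Op_pt b hφ.2 hq hv

theorem Op_Cl (b : Bool) {φ : ℝ → ℂ} {C : ℝ} (hφ : Cl φ C) : Cl (Op b φ) (C * I0) := by
  constructor
  · have : StronglyMeasurable (Function.uncurry fun q v => φ (gop b q v) * (hop b q v : ℂ)) := by
      apply Measurable.stronglyMeasurable
      exact (hφ.1.comp (meas_gop b)).mul (Complex.measurable_ofReal.comp (meas_hop b))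
    exact (this.integral_prod_right (ν := mu)).measurable
  · intro q hq
    calc ‖Op b φ q‖ ≤ ∫ v, C * √q * (1 / √v) ∂mu := by
          apply norm_integral_le_of_norm_le (isq_int.const_mul _)
          exact ae_mu fun v hv => Op_pt b hφ.2 hq hv
      _ = C * I0 * √q := by rw [integral_const_mul, I0]; ring

theorem Op_congr (b : Bool) {φ φ' : ℝ → ℂ} (h : ∀ p ∈ Ioo (0 : ℝ) 1, φ p = φ' p) :
    ∀ q ∈ Ioo (0 : ℝ) 1, Op b φ q = Op b φ' q := by
  intro q hq
  apply integral_congr_ae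
  exact ae_mu fun v hv => by simp only; rw [h _ (gop_mem b hq hv)]

theorem J_congr (l : List Bool) : ∀ {φ φ' : ℝ → ℂ}, (∀ p ∈ Ioo (0 : ℝ) 1, φ p = φ' p) →
    J l φ = J l φ' := by
  induction l with
  | nil =>
    intro φ φ' h
    simp only [J]
    congr 1
    apply integral_congr_ae
    exact ae_mu fun v hv => by simp only; rw [h _ hv]
  | cons b l ih =>
    intro φ φ' h
    exact ih (Op_congr b h)

theorem J0_pt {φ : ℝ → ℂ} {C : ℝ} (hφ : ∀ p ∈ Ioo (0 : ℝ) 1, ‖φ p‖ ≤ C * √p) {p : ℝ}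
    (hp : p ∈ Ioo (0 : ℝ) 1) : ‖φ p * ((1 / p : ℝ) : ℂ)‖ ≤ C * (1 / √p) := by
  rw [norm_mul, Complex.norm_real, Real.norm_of_nonneg (one_div_nonneg.mpr hp.1.le)]
  have hs := Real.sqrt_pos.mpr hp.1
  calc _ ≤ C * √p * (1 / p) := by
        gcongr
        · exact one_div_nonneg.mpr hp.1.le
        · exact hφ p hp
    _ = C * (1 / √p) := by
        have := Real.sq_sqrt hp.1.le
        have hp0 := hp.1.ne'
        field_simp
        rw [this]

theorem J0_int {φ : ℝ → ℂ} {C : ℝ} (hφ : Cl φ C) :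
    Integrable (fun p => φ p * ((1 / p : ℝ) : ℂ)) mu := by
  refine Integrable.mono' (isq_int.const_mul C) ?_ (ae_mu fun p hp => J0_pt hφ.2 hp)
  apply Measurable.aestronglyMeasurable
  apply hφ.1.mul
  apply Complex.measurable_ofReal.comp
  fun_prop

theorem Cl_add {φ φ' : ℝ → ℂ} {C C' : ℝ} (h : Cl φ C) (h' : Cl φ' C') :
    Cl (fun p => φ p + φ' p) (C + C') := by
  refine ⟨h.1.add h'.1, fun p hp => ?_⟩
  calc _ ≤ ‖φ p‖ + ‖φ' p‖ := norm_add_le _ _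
    _ ≤ C * √p + C' * √p := add_le_add (h.2 p hp) (h'.2 p hp)
    _ = _ := by ring

theorem Cl_smul {φ : ℝ → ℂ} {C : ℝ} (a : ℂ) (h : Cl φ C) :
    Cl (fun p => a * φ p) (‖a‖ * C) := by
  refine ⟨h.1.const_mul a, fun p hp => ?_⟩
  rw [norm_mul, mul_assoc]
  gcongr
  exact h.2 p hp

theorem J_add (l : List Bool) : ∀ {φ φ' : ℝ → ℂ} {C C' : ℝ}, Cl φ C → Cl φ' C' →
    J l (fun p => φ p + φ' p) = J l φ + J l φ' := by
  induction l with
  | nil =>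
    intro φ φ' C C' h h'
    simp only [J, add_mul]
    rw [integral_add (J0_int h) (J0_int h')]
    ring
  | cons b l ih =>
    intro φ φ' C C' h h'
    simp only [J]
    rw [← ih (Op_Cl b h) (Op_Cl b h')]
    apply J_congr
    intro q hq
    simp only [Op, add_mul]
    rw [integral_add (Op_int b h hq) (Op_int b h' hq)]

theorem J_smul (l : List Bool) : ∀ {φ : ℝ → ℂ} (a : ℂ),
    J l (fun p => a * φ p) = a * J l φ := by
  induction l with
  | nil =>
    intro φ a
    simp only [J, mul_assoc]
    rw [integral_const_mul]
    ring
  | cons b l ih =>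
    intro φ a
    simp only [J]
    rw [← ih]
    apply J_congr
    intro q hq
    simp only [Op, mul_assoc]
    rw [integral_const_mul]

theorem J_tendsto (l : List Bool) : ∀ {φ : ℝ → ℝ → ℂ} {φ' : ℝ → ℂ} {C : ℝ},
    (∀ᶠ x in atTop, Cl (φ x) C) →
    (∀ p ∈ Ioo (0 : ℝ) 1, Tendsto (fun x => φ x p) atTop (𝓝 (φ' p))) →
    Tendsto (fun x => J l (φ x)) atTop (𝓝 (J l φ')) := by
  induction l with
  | nil =>
    intro φ φ' C h1 h2
    simp only [J]
    apply Tendsto.neg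
    apply tendsto_integral_filter_of_dominated_convergence (fun p => C * (1 / √p))
    · filter_upwards [h1] with x hx
      exact (J0_int hx).1
    · filter_upwards [h1] with x hx
      exact ae_mu fun p hp => J0_pt hx.2 hp
    · exact isq_int.const_mul C
    · exact ae_mu fun p hp => (h2 p hp).mul_const _
  | cons b l ih =>
    intro φ φ' C h1 h2
    simp only [J]
    apply ih (C := C * I0)
    · filter_upwards [h1] with x hx
      exact Op_Cl b hx
    · intro q hq
      simp only [Op]
      apply tendsto_integral_filter_of_dominated_convergence (fun v => C * √q * (1 / √v))
      · filter_upwards [h1] with x hx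
        exact (Op_int b hx hq).1
      · filter_upwards [h1] with x hx
        exact ae_mu fun p hp => Op_pt b hx.2 hq hp
      · exact isq_int.const_mul _
      · exact ae_mu fun p hp => (h2 _ (gop_mem b hq hp)).mul_const _

theorem J_comm (l : List Bool) : ∀ {Φ : ℝ → ℝ → ℂ} {C : ℝ},
    Measurable (Function.uncurry Φ) →
    (∀ u ∈ Ioo (0 : ℝ) 1, ∀ p ∈ Ioo (0 : ℝ) 1, ‖Φ u p‖ ≤ C * (1 / √u) * √p) →
    J l (fun p => ∫ u, Φ u p ∂mu) = ∫ u, J l (Φ u) ∂mu := by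
  induction l with
  | nil =>
    intro Φ C hm hb
    simp only [J]
    rw [integral_neg]
    congr 1
    simp only [← integral_mul_const]
    rw [integral_integral_swap]
    refine Integrable.mono' ((isq_int.const_mul C).mul_prod isq_int) ?_ ?_
    · apply Measurable.aestronglyMeasurable
      apply Measurable.mul
      · exact hm.comp measurable_swap
      · apply Complex.measurable_ofReal.comp
        fun_prop
    · have hae : ∀ᵐ z : ℝ × ℝ ∂(mu.prod mu), z ∈ Ioo (0 : ℝ) 1 ×ˢ Ioo (0 : ℝ) 1 := by
        rw [mu, Measure.prod_restrict]
        exact ae_restrict_mem (measurableSet_Ioo.prod measurableSet_Ioo)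
      filter_upwards [hae] with z hz
      have := J0_pt (hb z.2 hz.2) hz.1
      refine this.trans (le_of_eq ?_)
      ring
  | cons b l ih =>
    intro Φ C hm hb
    simp only [J]
    rw [← ih (Φ := fun u => Op b (Φ u)) (C := C * I0)]
    · apply J_congr
      intro q hq
      simp only [Op, ← integral_mul_const]
      rw [integral_integral_swap]
      refine Integrable.mono' ((isq_int.const_mul (C * √q)).mul_prod isq_int) ?_ ?_
      · apply Measurable.aestronglyMeasurable
        apply Measurable.mul
        · exact hm.comp (f := fun a : ℝ × ℝ => (a.2, gop b q a.1)) (Measurable.prodMk measurable_snd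
            ((meas_gop b).comp (measurable_const.prodMk measurable_fst)))
        · apply Complex.measurable_ofReal.comp
          exact (meas_hop b).comp (measurable_const.prodMk measurable_fst)
      · have hae : ∀ᵐ z : ℝ × ℝ ∂(mu.prod mu), z ∈ Ioo (0 : ℝ) 1 ×ˢ Ioo (0 : ℝ) 1 := by
          rw [mu, Measure.prod_restrict]
          exact ae_restrict_mem (measurableSet_Ioo.prod measurableSet_Ioo)
        filter_upwards [hae] with z hz
        have := Op_pt b (hb z.2 hz.2) hq hz.1
        refine this.trans (le_of_eq ?_)
        ring
    · have : StronglyMeasurable (Function.uncurry fun (z : ℝ × ℝ) (v : ℝ) =>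
          Φ z.1 (gop b z.2 v) * (hop b z.2 v : ℂ)) := by
        apply Measurable.stronglyMeasurable
        apply Measurable.mul
        · exact hm.comp (f := fun a : (ℝ × ℝ) × ℝ => (a.1.1, gop b a.1.2 a.2))
            (Measurable.prodMk (measurable_fst.comp measurable_fst)
            ((meas_gop b).comp ((measurable_snd.comp measurable_fst).prodMk measurable_snd)))
        · apply Complex.measurable_ofReal.comp
          exact (meas_hop b).comp ((measurable_snd.comp measurable_fst).prodMk measurable_snd)
      exact (this.integral_prod_right (ν := mu)).measurable
    · intro u hu q hq
      calc ‖Op b (Φ u) q‖ ≤ ∫ v, C * (1 / √u) * √q * (1 / √v) ∂mu := by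
            apply norm_integral_le_of_norm_le (isq_int.const_mul _)
            exact ae_mu fun v hv => Op_pt b (hb u hu) hq hv
        _ = C * I0 * (1 / √u) * √q := by rw [integral_const_mul, I0]; ring

end Ana
end RTM

namespace RTM
section FunSp
open MeasureTheory Set Filter Topology

/-- The function space. -/
def Fs : Submodule ℚ (ℝ → ℂ) where
  carrier := {F | Measurable F ∧ ContinuousOn F (Ioi 0) ∧ ∃ C : ℝ, ∀ x > 0, ‖F x‖ ≤ C * √x}
  zero_mem' := ⟨measurable_const, continuousOn_const, 0, by simp⟩
  add_mem' := by
    rintro F F' ⟨h1, h2, C, h3⟩ ⟨h1', h2', C', h3'⟩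
    refine ⟨h1.add h1', h2.add h2', C + C', fun x hx => ?_⟩
    calc ‖F x + F' x‖ ≤ ‖F x‖ + ‖F' x‖ := norm_add_le _ _
      _ ≤ C * √x + C' * √x := add_le_add (h3 x hx) (h3' x hx)
      _ = _ := by ring
  smul_mem' := by
    rintro a F ⟨h1, h2, C, h3⟩
    have e : a • F = fun x => (a : ℂ) * F x := by
      funext x; simp [Rat.smul_def]
    rw [e]
    refine ⟨h1.const_mul _, continuousOn_const.mul h2, ‖(a : ℂ)‖ * C, fun x hx => ?_⟩
    rw [norm_mul, mul_assoc]
    gcongr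
    exact h3 x hx

/-- rescaling -/
def sc (F : ℝ → ℂ) (x : ℝ) : ℝ → ℂ := fun p => F (p * x)

theorem sc_Cl {F : ℝ → ℂ} (hF : F ∈ Fs) : ∃ C : ℝ, ∀ x > 0, Cl (sc F x) (C * √x) := by
  obtain ⟨h1, h2, C, h3⟩ := hF
  refine ⟨C, fun x hx => ⟨h1.comp (measurable_id.mul_const x), fun p hp => ?_⟩⟩
  have := h3 (p * x) (mul_pos hp.1 hx)
  rw [Real.sqrt_mul hp.1.le] at this
  calc _ ≤ _ := this
    _ = _ := by ring

theorem sc_Cl' {F : ℝ → ℂ} (hF : F ∈ Fs) {x : ℝ} (hx : 0 < x) : ∃ C : ℝ, Cl (sc F x) C := by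
  obtain ⟨C, h⟩ := sc_Cl hF
  exact ⟨_, h x hx⟩

noncomputable def II (F : ℝ → ℂ) (x : ℝ) : ℂ :=
  if 0 < x then ∫ v, F (v * x) * ((1 / v : ℝ) : ℂ) ∂mu else 0

theorem II_pos (F : ℝ → ℂ) {x : ℝ} (hx : 0 < x) :
    II F x = ∫ v, F (v * x) * ((1 / v : ℝ) : ℂ) ∂mu := if_pos hx

theorem II_J (F : ℝ → ℂ) {x : ℝ} (hx : 0 < x) : II F x = - J [] (sc F x) := by
  rw [II_pos F hx, J, neg_neg]; rfl

theorem II_congr {F F' : ℝ → ℂ} (h : ∀ x > 0, F x = F' x) {x : ℝ} (hx : 0 < x) :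
    II F x = II F' x := by
  rw [II_J F hx, II_J F' hx]
  congr 1
  apply J_congr
  intro p hp
  exact h _ (mul_pos hp.1 hx)

theorem mu_eq (f : ℝ → ℂ) : ∫ v, f v ∂mu = ∫ v in (0 : ℝ)..1, f v := by
  rw [mu, intervalIntegral.integral_of_le zero_le_one, integral_Ioc_eq_integral_Ioo]

theorem II_interval (F : ℝ → ℂ) {x : ℝ} (hx : 0 < x) :
    II F x = ∫ y in (0 : ℝ)..x, F y * ((1 / y : ℝ) : ℂ) := by
  have h := intervalIntegral.integral_comp_mul_right (a := 0) (b := 1)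
    (fun y => F y * ((1 / y : ℝ) : ℂ)) hx.ne'
  rw [zero_mul, one_mul] at h
  rw [II_pos F hx, mu_eq]
  have h2 : ∫ y in (0 : ℝ)..x, F y * ((1 / y : ℝ) : ℂ) =
      x • ∫ v in (0 : ℝ)..1, F (v * x) * ((1 / (v * x) : ℝ) : ℂ) := by
    rw [h, smul_smul, mul_inv_cancel₀ hx.ne', one_smul]
  rw [h2, ← intervalIntegral.integral_smul]
  congr 1
  funext v
  rw [Complex.real_smul]
  have : ((1 / v : ℝ) : ℂ) = (x : ℂ) * ((1 / (v * x) : ℝ) : ℂ) := by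
    rw [← Complex.ofReal_mul]
    congr 1
    field_simp
  rw [this]; ring

theorem F_intble {F : ℝ → ℂ} (hF : F ∈ Fs) {x : ℝ} (hx : 0 < x) :
    IntervalIntegrable (fun y => F y * ((1 / y : ℝ) : ℂ)) volume 0 x := by
  obtain ⟨h1, h2, C, h3⟩ := hF
  have h := (intervalIntegral.intervalIntegrable_rpow' (a := 0) (b := x) (r := -(1 / 2))
    (by norm_num)).const_mul C
  refine h.mono_fun' ?_ ?_
  · apply Measurable.aestronglyMeasurable
    apply h1.mul
    apply Complex.measurable_ofReal.comp
    fun_prop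
  · rw [uIoc_of_le hx.le]
    refine (ae_restrict_iff' measurableSet_Ioc).mpr (ae_of_all _ fun y hy => ?_)
    have hy0 : 0 < y := hy.1
    simp only
    rw [norm_mul, Complex.norm_real, Real.norm_of_nonneg (one_div_nonneg.mpr hy0.le),
      Real.rpow_neg hy0.le, ← Real.sqrt_eq_rpow]
    have hs := Real.sqrt_pos.mpr hy0
    have e : (√y)⁻¹ = √y * (1 / y) := by
      have := Real.sq_sqrt hy0.le
      field_simp
      exact this.symm
    rw [e, ← mul_assoc]
    gcongr
    exact h3 y hy0

theorem II_deriv {F : ℝ → ℂ} (hF : F ∈ Fs) {x : ℝ} (hx : 0 < x) :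
    HasDerivAt (II F) (F x / x) x := by
  have hc : ContinuousOn (fun y => F y * ((1 / y : ℝ) : ℂ)) (Ioi 0) := by
    apply hF.2.1.mul
    apply Complex.continuous_ofReal.comp_continuousOn
    apply continuousOn_const.div continuousOn_id
    intro y hy
    exact (ne_of_gt hy)
  have hm : Measurable (fun y => F y * ((1 / y : ℝ) : ℂ)) := by
    apply hF.1.mul
    apply Complex.measurable_ofReal.comp
    fun_prop
  have h := intervalIntegral.integral_hasDerivAt_right (F_intble hF hx)
    (hm.stronglyMeasurable.stronglyMeasurableAtFilter)
    (hc.continuousAt (Ioi_mem_nhds hx))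
  have e : F x * ((1 / x : ℝ) : ℂ) = F x / x := by
    push_cast; ring
  rw [e] at h
  refine h.congr_of_eventuallyEq ?_
  filter_upwards [Ioi_mem_nhds hx] with y hy
  exact II_interval F hy

theorem II_bound {F : ℝ → ℂ} {C : ℝ} (h3 : ∀ x > 0, ‖F x‖ ≤ C * √x) {x : ℝ} (hx : 0 < x) :
    ‖II F x‖ ≤ C * I0 * √x := by
  rw [II_pos F hx]
  calc _ ≤ ∫ v, C * √x * (1 / √v) ∂mu := by
        apply norm_integral_le_of_norm_le (isq_int.const_mul _)
        refine ae_mu fun v hv => ?_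
        refine J0_pt (φ := sc F x) (C := C * √x) ?_ hv
        intro p hp
        have := h3 (p * x) (mul_pos hp.1 hx)
        rw [Real.sqrt_mul hp.1.le] at this
        calc _ ≤ _ := this
          _ = _ := by ring
    _ = _ := by rw [integral_const_mul, I0]; ring

theorem II_mem {F : ℝ → ℂ} (hF : F ∈ Fs) : II F ∈ Fs := by
  refine ⟨?_, ?_, ?_⟩
  · apply Measurable.ite measurableSet_Ioi _ measurable_const
    have : StronglyMeasurable (Function.uncurry fun (x v : ℝ) =>
        F (v * x) * ((1 / v : ℝ) : ℂ)) := by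
      apply Measurable.stronglyMeasurable
      apply Measurable.mul
      · exact hF.1.comp (measurable_snd.mul measurable_fst)
      · apply Complex.measurable_ofReal.comp
        fun_prop
    exact (this.integral_prod_right (ν := mu)).measurable
  · intro x hx
    exact (II_deriv hF hx).continuousAt.continuousWithinAt
  · obtain ⟨_, _, C, h3⟩ := hF
    exact ⟨C * I0, fun x hx => II_bound h3 hx⟩

theorem II_add {F F' : ℝ → ℂ} (hF : F ∈ Fs) (hF' : F' ∈ Fs) : II (F + F') = II F + II F' := by
  funext x
  by_cases hx : 0 < x
  · obtain ⟨C, hC⟩ := sc_Cl' hF hx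
    obtain ⟨C', hC'⟩ := sc_Cl' hF' hx
    rw [Pi.add_apply, II_J _ hx, II_J _ hx, II_J _ hx]
    have := J_add [] hC hC'
    rw [← neg_add, ← this]
    rfl
  · simp [II, hx]

theorem II_smul (F : ℝ → ℂ) (a : ℚ) : II (a • F) = a • II F := by
  funext x
  by_cases hx : 0 < x
  · rw [Pi.smul_apply, II_J _ hx, II_J _ hx, Rat.smul_def]
    have := J_smul [] (φ := sc F x) a
    rw [mul_neg, ← this]
    congr 2
  · simp [II, hx]

noncomputable def IIl : Fs →ₗ[ℚ] Fs where
  toFun F := ⟨II F.1, II_mem F.2⟩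
  map_add' F F' := Subtype.ext (II_add F.2 F'.2)
  map_smul' a F := Subtype.ext (II_smul F.1 a)

theorem Fs_zero {F : ℝ → ℂ} (hF : F ∈ Fs) : Tendsto F (𝓝[>] 0) (𝓝 0) := by
  obtain ⟨_, _, C, h3⟩ := hF
  have h : Tendsto (fun x : ℝ => C * √x) (𝓝[>] 0) (𝓝 0) := by
    have : Tendsto (fun x : ℝ => C * √x) (𝓝 0) (𝓝 (C * √0)) :=
      (continuous_const.mul Real.continuous_sqrt).tendsto 0
    rw [Real.sqrt_zero, mul_zero] at this
    exact this.mono_left nhdsWithin_le_nhds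
  refine squeeze_zero_norm' ?_ h
  filter_upwards [self_mem_nhdsWithin] with x hx
  exact h3 x hx

theorem II_unique {K : ℝ → ℂ} (hK : K ∈ Fs) {g : ℝ → ℂ}
    (hd : ∀ x > 0, HasDerivAt g (K x / x) x) (h0 : Tendsto g (𝓝[>] 0) (𝓝 0)) :
    ∀ x > 0, II K x = g x := by
  have hd2 : ∀ x > 0, HasDerivAt (fun x => II K x - g x) 0 x := by
    intro x hx
    have := (II_deriv hK hx).sub (hd x hx)
    rw [sub_self] at this
    exact this
  have hc : ∀ x > 0, ∀ y > 0, II K x - g x = II K y - g y := by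
    intro x hx y hy
    refine (isOpen_Ioi (a := (0 : ℝ))).is_const_of_deriv_eq_zero (isPreconnected_Ioi)
      (f := fun x => II K x - g x) ?_ ?_ hx hy
    · intro z hz
      exact (hd2 z hz).differentiableAt.differentiableWithinAt
    · intro z hz
      exact (hd2 z hz).deriv
  intro x hx
  have l1 : Tendsto (fun y => II K y - g y) (𝓝[>] 0) (𝓝 (0 - 0)) := (Fs_zero (II_mem hK)).sub h0
  have l2 : Tendsto (fun y => II K y - g y) (𝓝[>] 0) (𝓝 (II K x - g x)) := by
    refine tendsto_const_nhds.congr' ?_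
    filter_upwards [self_mem_nhdsWithin] with y hy
    exact hc x hx y hy
  have := tendsto_nhds_unique l1 l2
  rw [sub_zero] at this
  exact (sub_eq_zero.mp this.symm)

theorem J_II {F : ℝ → ℂ} (hF : F ∈ Fs) (l : List Bool) {x : ℝ} (hx : 0 < x) :
    ∫ u, J l (sc F (u * x)) * ((1 / u : ℝ) : ℂ) ∂mu = J l (sc (II F) x) := by
  obtain ⟨h1, h2, C, h3⟩ := hF
  have e : J l (sc (II F) x) = J l (fun p => ∫ u, ((1 / u : ℝ) : ℂ) * F (p * (u * x)) ∂mu) := by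
    apply J_congr
    intro p hp
    rw [sc, II_pos F (mul_pos hp.1 hx)]
    congr 1
    funext u
    rw [mul_comm]
    congr 2
    ring
  rw [e, J_comm l (Φ := fun u p => ((1 / u : ℝ) : ℂ) * F (p * (u * x))) (C := C * √x)]
  · congr 1
    funext u
    rw [J_smul, mul_comm]
    rfl
  · apply Measurable.mul
    · apply Complex.measurable_ofReal.comp
      fun_prop
    · exact h1.comp (f := fun a : ℝ × ℝ => a.2 * (a.1 * x)) (by fun_prop)
  · intro u hu p hp
    have hup : 0 < p * (u * x) := mul_pos hp.1 (mul_pos hu.1 hx)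
    have := h3 _ hup
    rw [Real.sqrt_mul hp.1.le, Real.sqrt_mul hu.1.le] at this
    rw [norm_mul, Complex.norm_real, Real.norm_of_nonneg (one_div_nonneg.mpr hu.1.le)]
    have hu0 : 0 ≤ 1 / u := one_div_nonneg.mpr hu.1.le
    calc _ ≤ (1 / u) * (C * (√p * (√u * √x))) := by gcongr
      _ = _ := by
        have hs := Real.sqrt_pos.mpr hu.1
        have hp0 := hu.1.ne'
        field_simp
        rw [Real.sq_sqrt hu.1.le]
        ring

theorem II_of_J {F E : ℝ → ℂ} (hF : F ∈ Fs) (l : List Bool)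
    (h : ∀ x > 0, E x = J l (sc F x)) {x : ℝ} (hx : 0 < x) :
    II E x = J l (sc (II F) x) := by
  rw [← J_II hF l hx, II_pos E hx]
  apply integral_congr_ae
  refine ae_mu fun u hu => ?_
  simp only
  rw [h _ (mul_pos hu.1 hx)]

theorem J_false (F : ℝ → ℂ) (l : List Bool) {x : ℝ} (hx : 0 < x) :
    J (false :: l) (sc F x) = J l (sc (II F) x) := by
  rw [J]
  apply J_congr
  intro q hq
  rw [sc, II_pos F (mul_pos hq.1 hx), Op]
  congr 1
  funext v
  simp only [gop, hop, sc]
  congr 2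
  ring

end FunSp
end RTM

namespace RTM
section Rep
open MeasureTheory Set Filter Topology

noncomputable def kp (a : ℂ) (x : ℝ) : ℂ := 1 / (1 + a * x)

theorem kp_re {a : ℂ} (x : ℝ) : (1 + a * (x : ℂ)).re = 1 + a.re * x := by
  simp

theorem kp_ne {a : ℂ} (ha : 0 < a.re) {x : ℝ} (hx : 0 < x) : (1 + a * (x : ℂ)) ≠ 0 := by
  intro h
  have := kp_re (a := a) x
  rw [h] at this
  simp at this
  nlinarith [mul_pos ha hx]

theorem kp_den {a : ℂ} (x : ℝ) :
    1 + a.re * x ≤ ‖1 + a * (x : ℂ)‖ := by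
  rw [← kp_re]
  exact Complex.re_le_norm _

theorem kp_norm {a : ℂ} (ha : 0 < a.re) {x : ℝ} (hx : 0 < x) :
    ‖kp a x‖ ≤ 1 / (1 + a.re * x) := by
  rw [kp, norm_div, norm_one]
  have := mul_pos ha hx
  have := kp_den (a := a) x
  gcongr

theorem kp_le_one {a : ℂ} (ha : 0 < a.re) {x : ℝ} (hx : 0 < x) : ‖kp a x‖ ≤ 1 := by
  refine (kp_norm ha hx).trans ?_
  have := mul_pos ha hx
  rw [div_le_one (by linarith)]
  linarith

theorem kp_one_sub {a : ℂ} (ha : 0 < a.re) {x : ℝ} (hx : 0 < x) :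
    1 - kp a x = a * x * kp a x := by
  have := kp_ne ha hx
  rw [kp]
  field_simp
  ring

theorem kp_sub_bound {a : ℂ} (ha : 0 < a.re) : ∃ C : ℝ, ∀ x > 0, ‖kp a x - 1‖ ≤ C * √x := by
  refine ⟨‖a‖ / min 1 a.re, fun x hx => ?_⟩
  rw [norm_sub_rev, kp_one_sub ha hx, norm_mul, norm_mul, Complex.norm_real,
    Real.norm_of_nonneg hx.le]
  have hm : 0 < min 1 a.re := lt_min one_pos ha
  have hax := mul_pos ha hx
  have hs : 0 < √x := Real.sqrt_pos.mpr hx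
  have hsx := Real.sq_sqrt hx.le
  have h1 : min 1 a.re * √x ≤ 1 + a.re * x := by
    have : min 1 a.re * √x ≤ min 1 a.re * (1 + x) := by
      gcongr; nlinarith
    have h2 : min 1 a.re * x ≤ a.re * x := by gcongr; exact min_le_right _ _
    have h3 : min 1 a.re ≤ 1 := min_le_left _ _
    linarith
  calc ‖a‖ * x * ‖kp a x‖ ≤ ‖a‖ * x * (1 / (1 + a.re * x)) := by
        gcongr; exact kp_norm ha hx
    _ ≤ ‖a‖ * x * (1 / (min 1 a.re * √x)) := by gcongr
    _ = ‖a‖ / min 1 a.re * √x := by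
        field_simp
        rw [hsx]

theorem kp_meas (a : ℂ) : Measurable (kp a) := by
  unfold kp
  apply measurable_const.div
  apply measurable_const.add
  exact Complex.measurable_ofReal.const_mul a

theorem kp_cont {a : ℂ} (ha : 0 < a.re) : ContinuousOn (kp a) (Ioi 0) := by
  unfold kp
  apply continuousOn_const.div
  · fun_prop
  · intro x hx
    exact kp_ne ha hx

theorem kp_deriv {a : ℂ} (ha : 0 < a.re) {x : ℝ} (hx : 0 < x) :
    HasDerivAt (kp a) (-(kp a x * (1 - kp a x)) / x) x := by
  have h := kp_ne ha hx
  have hx0 : (x : ℂ) ≠ 0 := by exact_mod_cast hx.ne'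
  have h1 : HasDerivAt (fun y : ℝ => 1 + a * (y : ℂ)) a x := by
    have := ((hasDerivAt_id x).ofReal_comp.const_mul a).const_add 1
    simpa using this
  have h2 := h1.inv h
  have e : kp a = (fun y : ℝ => 1 + a * (y : ℂ))⁻¹ := by
    funext y; simp [kp]
  rw [← e] at h2
  have e2 : -(kp a x * (1 - kp a x)) / (x : ℂ) = -a / (1 + a * (x : ℂ)) ^ 2 := by
    rw [kp_one_sub ha hx, kp]
    field_simp
  rw [e2]
  exact h2

theorem Fs_kmul {a : ℂ} (ha : 0 < a.re) {F : ℝ → ℂ} (hF : F ∈ Fs) :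
    (fun x => kp a x * F x) ∈ Fs := by
  obtain ⟨h1, h2, C, h3⟩ := hF
  refine ⟨(kp_meas a).mul h1, (kp_cont ha).mul h2, C, fun x hx => ?_⟩
  rw [norm_mul]
  calc _ ≤ 1 * ‖F x‖ := by gcongr; exact kp_le_one ha hx
    _ ≤ _ := by rw [one_mul]; exact h3 x hx

theorem Fs_cmul (b : ℂ) {F : ℝ → ℂ} (hF : F ∈ Fs) : (fun x => b * F x) ∈ Fs := by
  obtain ⟨h1, h2, C, h3⟩ := hF
  refine ⟨h1.const_mul _, continuousOn_const.mul h2, ‖b‖ * C, fun x hx => ?_⟩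
  rw [norm_mul, mul_assoc]
  gcongr
  exact h3 x hx

theorem Fs_k1 {a : ℂ} (ha : 0 < a.re) : (fun x => kp a x - 1) ∈ Fs := by
  obtain ⟨C, h⟩ := kp_sub_bound ha
  exact ⟨(kp_meas a).sub measurable_const, (kp_cont ha).sub continuousOn_const, C, h⟩

/-- parameters -/
structure Par (G : Type) where
  c : G → ℂ
  hc : ∀ t, 0 < (c t).re

variable (pr : Par G)

noncomputable def Gl (t : G) : (Fs × ℂ) →ₗ[ℚ] Fs where
  toFun p := ⟨fun x => kp (pr.c t) x * p.1.1 x + p.2 * (kp (pr.c t) x - 1),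
    Fs.add_mem (Fs_kmul (pr.hc t) p.1.2) (Fs_cmul p.2 (Fs_k1 (pr.hc t)))⟩
  map_add' p p' := by
    apply Subtype.ext
    funext x
    simp
    ring
  map_smul' a p := by
    apply Subtype.ext
    funext x
    simp [Rat.smul_def]
    ring

noncomputable def Zo : Module.End ℚ (Fs × ℂ) :=
  LinearMap.prod (IIl.comp (LinearMap.fst ℚ _ _)) 0

noncomputable def To (t : G) : Module.End ℚ (Fs × ℂ) :=
  LinearMap.prod (IIl.comp (Gl pr t)) 0

open scoped Classical in
noncomputable def rho : Ar G →ₐ[ℚ] Module.End ℚ (Fs × ℂ) :=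
  lift ℚ (fun l => match l with
    | LetR.x => To pr 1
    | LetR.y s => if s = 1 then Zo - To pr 1 else To pr s - To pr 1)

theorem rho_z : rho pr zet = Zo := by
  simp [rho, zet, Xr, Yr]
  abel

theorem rho_t (t : G) : rho pr (zdel t) = To pr t := by
  by_cases h : t = 1
  · subst h
    simp [rho, zdel, Xr]
  · simp [rho, zdel, h, Xr, Yr]
    abel

noncomputable def FFl : Ar G →ₗ[ℚ] Fs :=
  (LinearMap.fst ℚ Fs ℂ).comp ((LinearMap.applyₗ ((0 : Fs), (1 : ℂ))).comp (rho pr).toLinearMap)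

theorem FFl_eq (w : Ar G) : FFl pr w = (rho pr w (0, 1)).1 := rfl

theorem rho_snd (w : Ar G) : (rho pr w (0, 1)).2 = (ep G w : ℂ) := by
  let e1 : Ar G →ₗ[ℚ] ℂ :=
    (LinearMap.snd ℚ Fs ℂ).comp ((LinearMap.applyₗ ((0 : Fs), (1 : ℂ))).comp (rho pr).toLinearMap)
  let e2 : Ar G →ₗ[ℚ] ℂ := (Algebra.linearMap ℚ ℂ).comp (ep G).toLinearMap
  have : w ∈ LinearMap.eqLocus e1 e2 := by
    apply indL
    · change (rho pr 1 (0, 1)).2 = algebraMap ℚ ℂ (ep G 1)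
      simp
    · intro w _
      change (rho pr (zet * w) (0, 1)).2 = algebraMap ℚ ℂ (ep G (zet * w))
      rw [map_mul, map_mul, rho_z, ep_z, Module.End.mul_apply]
      simp [Zo]
    · intro t w _
      change (rho pr (zdel t * w) (0, 1)).2 = algebraMap ℚ ℂ (ep G (zdel t * w))
      rw [map_mul, map_mul, rho_t, ep_zt, Module.End.mul_apply]
      simp [To]
  exact this

noncomputable def FF (w : Ar G) : ℝ → ℂ := (FFl pr w).1

theorem FF_mem (w : Ar G) : FF pr w ∈ Fs := (FFl pr w).2

noncomputable def Gt (t : G) (w : Ar G) : ℝ → ℂ :=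
  fun x => kp (pr.c t) x * FF pr w x + (ep G w : ℂ) * (kp (pr.c t) x - 1)

theorem Gt_mem (t : G) (w : Ar G) : Gt pr t w ∈ Fs :=
  Fs.add_mem (Fs_kmul (pr.hc t) (FF_mem pr w)) (Fs_cmul _ (Fs_k1 (pr.hc t)))

theorem FF_one : FF pr 1 = 0 := by
  rw [FF, FFl_eq]; simp

theorem FF_z (w : Ar G) : FF pr (zet * w) = II (FF pr w) := by
  rw [FF, FFl_eq, map_mul, rho_z, Module.End.mul_apply]
  rfl

theorem FF_t (t : G) (w : Ar G) : FF pr (zdel t * w) = II (Gt pr t w) := by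
  rw [FF, FFl_eq, map_mul, rho_t, Module.End.mul_apply]
  unfold Gt
  rw [← rho_snd pr w]
  rfl

theorem FF_add (w w' : Ar G) : FF pr (w + w') = FF pr w + FF pr w' := by
  rw [FF, map_add]; rfl
theorem FF_sub (w w' : Ar G) : FF pr (w - w') = FF pr w - FF pr w' := by
  rw [FF, map_sub]; rfl
theorem FF_neg (w : Ar G) : FF pr (- w) = - FF pr w := by
  rw [FF, map_neg]; rfl
theorem FF_smul (a : ℚ) (w : Ar G) : FF pr (a • w) = a • FF pr w := by
  rw [FF, map_smul]; rfl

noncomputable def vw : List Bool → A1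
  | [] => Y1
  | true :: l => X1 * vw l
  | false :: l => Z1 * vw l

theorem vw_ends (l : List Bool) : ∃ u, vw l = u * Y1 := by
  induction l with
  | nil => exact ⟨1, by simp [vw]⟩
  | cons b l ih =>
    obtain ⟨u, hu⟩ := ih
    cases b
    · exact ⟨Z1 * u, by rw [vw, hu, mul_assoc]⟩
    · exact ⟨X1 * u, by rw [vw, hu, mul_assoc]⟩

theorem II_zero : II 0 = 0 := by
  funext x
  simp [II]

theorem FF_qh (l : List Bool) : FF pr (qh G (vw l)) = 0 := by
  induction l with
  | nil =>
    rw [vw, qh_y]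
    have := FF_z pr 1
    rw [mul_one, FF_one, II_zero] at this
    exact this
  | cons b l ih =>
    cases b
    · rw [vw, map_mul, qh_z, FF_z, ih, II_zero]
    · rw [vw, map_mul, qh_x, zero_mul, FF, map_zero]; rfl

theorem J_zero (l : List Bool) : J l 0 = 0 := by
  have := J_smul l (φ := 0) 0
  rw [zero_mul] at this
  rw [← this]
  congr 1
  funext p
  simp

end Rep
end RTM

namespace RTM
section AQ
open MeasureTheory Set Filter Topology

noncomputable def Kf (a e : ℂ) (H F : ℝ → ℂ) : ℝ → ℂ :=
  fun x => kp a x * H x - kp a x * (1 - kp a x) * (F x + e)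

theorem Kf_mem {a : ℂ} (ha : 0 < a.re) (e : ℂ) {H F : ℝ → ℂ} (hH : H ∈ Fs) (hF : F ∈ Fs) :
    Kf a e H F ∈ Fs := by
  have h1 := Fs_kmul ha hH
  have h2 := Fs_kmul ha hF
  have h3 := Fs_kmul ha h2
  have h4 := Fs_cmul e (Fs_kmul ha (Fs_k1 ha))
  have := Fs.add_mem (Fs.add_mem (Fs.sub_mem h1 h2) h3) h4
  convert this using 1
  funext x
  simp only [Kf, Pi.add_apply, Pi.sub_apply]
  ring

/-- derivative of `κ (F + e)` -/
theorem Kf_deriv {a : ℂ} (ha : 0 < a.re) (e : ℂ) {H F : ℝ → ℂ} (hH : H ∈ Fs)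
    (hFH : ∀ x > 0, F x = II H x) {x : ℝ} (hx : 0 < x) :
    HasDerivAt (fun y => kp a y * (F y + e)) (Kf a e H F x / x) x := by
  have h1 : HasDerivAt F (H x / x) x := by
    refine (II_deriv hH hx).congr_of_eventuallyEq ?_
    filter_upwards [Ioi_mem_nhds hx] with y hy
    exact hFH y hy
  have h2 := (kp_deriv ha hx).mul (h1.add_const e)
  have e2 : Kf a e H F x / x =
      -(kp a x * (1 - kp a x)) / x * (F x + e) + kp a x * (H x / x) := by
    rw [Kf]; ring
  rw [e2]
  exact h2

theorem Kf_II {a : ℂ} (ha : 0 < a.re) (e : ℂ) {H F : ℝ → ℂ} (hH : H ∈ Fs) (hF : F ∈ Fs)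
    (hFH : ∀ x > 0, F x = II H x) : ∀ x > 0,
    II (Kf a e H F) x = kp a x * F x + e * (kp a x - 1) := by
  apply II_unique (Kf_mem ha e hH hF)
  · intro x hx
    have h := (Kf_deriv ha e hH hFH hx).sub_const e
    refine h.congr_of_eventuallyEq (Eventually.of_forall fun y => ?_)
    simp only
    ring
  · exact Fs_zero (Fs.add_mem (Fs_kmul ha hF) (Fs_cmul e (Fs_k1 ha)))

theorem Kf_int {a : ℂ} (ha : 0 < a.re) (e : ℂ) {H F : ℝ → ℂ} (hH : H ∈ Fs) (hF : F ∈ Fs)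
    (hFH : ∀ x > 0, F x = II H x) {x q : ℝ} (hx : 0 < x) (hq : q ∈ Ioo (0 : ℝ) 1) :
    ∫ v, (((1 - (q + (1 - q) * v) : ℝ) : ℂ) * Kf a e H F ((q + (1 - q) * v) * x) *
        ((1 / (q + (1 - q) * v) : ℝ) : ℂ) -
      kp a ((q + (1 - q) * v) * x) * (F ((q + (1 - q) * v) * x) + e)) ∂mu
    = - (kp a (q * x) * (F (q * x) + e)) := by
  have hpos : ∀ v ∈ Icc (0 : ℝ) 1, 0 < q + (1 - q) * v := by
    intro v hv
    have := mul_nonneg (sub_nonneg.mpr hq.2.le) hv.1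
    linarith [hq.1]
  have hK := Kf_mem ha e hH hF
  set K := Kf a e H F with hKdef
  set g : ℝ → ℂ := fun y => kp a y * (F y + e) with hg
  have hgc : ContinuousOn g (Ioi 0) := (kp_cont ha).mul (hF.2.1.add continuousOn_const)
  have hd : ∀ v ∈ uIcc (0 : ℝ) 1, HasDerivAt
      (fun v : ℝ => ((1 - (q + (1 - q) * v) : ℝ) : ℂ) * g ((q + (1 - q) * v) * x))
      ((1 - q : ℝ) * (((1 - (q + (1 - q) * v) : ℝ) : ℂ) * K ((q + (1 - q) * v) * x) *
        ((1 / (q + (1 - q) * v) : ℝ) : ℂ) - g ((q + (1 - q) * v) * x))) v := by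
    intro v hv
    rw [uIcc_of_le zero_le_one] at hv
    have hp := hpos v hv
    have hpx := mul_pos hp hx
    have d1 : HasDerivAt (fun v : ℝ => q + (1 - q) * v) (1 - q) v := by
      simpa using ((hasDerivAt_id v).const_mul (1 - q)).const_add q
    have d2 := (Kf_deriv ha e hH hFH hpx).scomp v (d1.mul_const x)
    have d3 := (d1.const_sub 1).ofReal_comp
    have d4 := d3.mul d2
    have e4 : ((1 - q : ℝ) * (((1 - (q + (1 - q) * v) : ℝ) : ℂ) * K ((q + (1 - q) * v) * x) *
        ((1 / (q + (1 - q) * v) : ℝ) : ℂ) - g ((q + (1 - q) * v) * x)) : ℂ) =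
      ((-(1 - q) : ℝ) : ℂ) * g ((q + (1 - q) * v) * x) +
      ((1 - (q + (1 - q) * v) : ℝ) : ℂ) * (((1 - q) * x) • (K ((q + (1 - q) * v) * x) /
        (((q + (1 - q) * v) * x : ℝ) : ℂ))) := by
      have hp' : ((q + (1 - q) * v : ℝ) : ℂ) ≠ 0 := by exact_mod_cast hp.ne'
      have hx' : (x : ℂ) ≠ 0 := by exact_mod_cast hx.ne'
      rw [Complex.real_smul, Complex.ofReal_mul (q + (1 - q) * v) x, Complex.ofReal_div]
      rw [Complex.ofReal_mul, Complex.ofReal_neg, Complex.ofReal_one]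
      field_simp
      ring
    rw [e4]
    exact d4
  have hcont : ContinuousOn (fun v : ℝ => ((1 - q : ℝ) * (((1 - (q + (1 - q) * v) : ℝ) : ℂ) *
      K ((q + (1 - q) * v) * x) *
        ((1 / (q + (1 - q) * v) : ℝ) : ℂ) - g ((q + (1 - q) * v) * x)) : ℂ)) (uIcc 0 1) := by
    rw [uIcc_of_le zero_le_one]
    have hl : ContinuousOn (fun v : ℝ => (q + (1 - q) * v) * x) (Icc 0 1) := by fun_prop
    have hmaps : MapsTo (fun v : ℝ => (q + (1 - q) * v) * x) (Icc 0 1) (Ioi 0) :=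
      fun v hv => mul_pos (hpos v hv) hx
    refine continuousOn_const.mul (ContinuousOn.sub ?_ (hgc.comp hl hmaps))
    refine ContinuousOn.mul (ContinuousOn.mul ?_ (hK.2.1.comp hl hmaps)) ?_
    · fun_prop
    · apply Complex.continuous_ofReal.comp_continuousOn
      apply continuousOn_const.div (by fun_prop)
      intro v hv
      exact (hpos v hv).ne'
  have h := intervalIntegral.integral_eq_sub_of_hasDerivAt hd hcont.intervalIntegrable
  rw [intervalIntegral.integral_const_mul] at h
  rw [mu_eq]
  have hq1 : ((1 - q : ℝ) : ℂ) ≠ 0 := by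
    have : 1 - q ≠ 0 := by linarith [hq.2]
    exact_mod_cast this
  apply mul_left_cancel₀ hq1
  rw [h]
  simp
  exact Or.inl rfl

theorem Kf_Op {a : ℂ} (ha : 0 < a.re) (e : ℂ) {H F : ℝ → ℂ} (hH : H ∈ Fs) (hF : F ∈ Fs)
    (hFH : ∀ x > 0, F x = II H x) {x q : ℝ} (hx : 0 < x) (hq : q ∈ Ioo (0 : ℝ) 1) :
    (1 + a * x) * Op true (sc (Kf a e H F) x) q =
      sc (fun y => kp a y * F y + e * (kp a y - 1)) x q + Op true (sc H x) q - sc F x q := by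
  have hK := Kf_mem ha e hH hF
  obtain ⟨CK, hCK⟩ := sc_Cl' hK hx
  obtain ⟨CH, hCH⟩ := sc_Cl' hH hx
  have iK := Op_int true hCK hq
  have iH := Op_int true hCH hq
  have hi := Kf_int ha e hH hF hFH hx hq
  have hqx := mul_pos hq.1 hx
  have e1 : sc (fun y => kp a y * F y + e * (kp a y - 1)) x q - sc F x q =
      - (a * x * q) * (kp a (q * x) * (F (q * x) + e)) := by
    have := kp_one_sub ha hqx
    push_cast at this
    simp only [sc]
    linear_combination -(F (q * x) + e) * this
  have e2 : (1 + a * x) * Op true (sc (Kf a e H F) x) q - Op true (sc H x) q =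
      (a * x * q) * ∫ v, (((1 - (q + (1 - q) * v) : ℝ) : ℂ) * Kf a e H F ((q + (1 - q) * v) * x) *
        ((1 / (q + (1 - q) * v) : ℝ) : ℂ) -
      kp a ((q + (1 - q) * v) * x) * (F ((q + (1 - q) * v) * x) + e)) ∂mu := by
    rw [Op, Op, ← integral_const_mul, ← integral_const_mul,
      ← integral_sub (iK.const_mul _) iH]
    apply integral_congr_ae
    refine ae_mu fun v hv => ?_
    have hp : 0 < q + (1 - q) * v := (gop_mem true hq hv).1
    have hpx := mul_pos hp hx
    have hk := kp_one_sub ha hpx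
    have hk2 := kp_ne ha hpx
    have hkk : kp a ((q + (1 - q) * v) * x) * (1 + a * (((q + (1 - q) * v) * x : ℝ) : ℂ)) = 1 := by
      rw [kp, one_div, inv_mul_cancel₀ hk2]
    simp only [gop, hop, sc]
    generalize hpp : q + (1 - q) * v = p at *
    have hp' : (p : ℂ) ≠ 0 := by exact_mod_cast hp.ne'
    have hKe : Kf a e H F (p * x) * (1 + a * ((p * x : ℝ) : ℂ)) =
        H (p * x) - a * ((p * x : ℝ) : ℂ) * (kp a (p * x) * (F (p * x) + e)) := by
      rw [Kf]
      linear_combination (H (p * x) - (1 - kp a (p * x)) * (F (p * x) + e)) * hkk -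
        (F (p * x) + e) * hk
    have hc1 : ((q / p : ℝ) : ℂ) = q * (1 / p) := by push_cast; ring
    have hc2 : ((1 / p : ℝ) : ℂ) = 1 / p := by push_cast; ring
    have hc3 : ((1 - p : ℝ) : ℂ) = 1 - p := by push_cast; ring
    have hc4 : ((p * x : ℝ) : ℂ) = p * x := by push_cast; ring
    rw [hc4] at hKe
    rw [hc1, hc2, hc3]
    have hpi : (p : ℂ) * (1 / p) = 1 := by field_simp
    generalize (1 / p : ℂ) = i at *
    linear_combination (q * i) * hKe - (a * x * q * (kp a (p * x) * (F (p * x) + e))) * hpi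
  rw [hi] at e2
  linear_combination e2 - e1

theorem J_meas (l : List Bool) : ∀ {Φ : ℝ → ℝ → ℂ}, Measurable (Function.uncurry Φ) →
    Measurable fun u => J l (Φ u) := by
  induction l with
  | nil =>
    intro Φ hm
    simp only [J]
    apply Measurable.neg
    have : StronglyMeasurable (Function.uncurry fun (u p : ℝ) =>
        Φ u p * ((1 / p : ℝ) : ℂ)) := by
      apply Measurable.stronglyMeasurable
      apply Measurable.mul hm
      apply Complex.measurable_ofReal.comp
      fun_prop
    exact (this.integral_prod_right (ν := mu)).measurable
  | cons b l ih =>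
    intro Φ hm
    simp only [J]
    apply ih (Φ := fun u => Op b (Φ u))
    have : StronglyMeasurable (Function.uncurry fun (z : ℝ × ℝ) (v : ℝ) =>
        Φ z.1 (gop b z.2 v) * (hop b z.2 v : ℂ)) := by
      apply Measurable.stronglyMeasurable
      apply Measurable.mul
      · exact hm.comp (f := fun a : (ℝ × ℝ) × ℝ => (a.1.1, gop b a.1.2 a.2))
          (Measurable.prodMk (measurable_fst.comp measurable_fst)
          ((meas_gop b).comp ((measurable_snd.comp measurable_fst).prodMk measurable_snd)))
      · apply Complex.measurable_ofReal.comp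
        exact (meas_hop b).comp ((measurable_snd.comp measurable_fst).prodMk measurable_snd)
    exact (this.integral_prod_right (ν := mu)).measurable

theorem J_bound (l : List Bool) : ∃ B : ℝ, ∀ {φ : ℝ → ℂ} {C : ℝ}, Cl φ C →
    ‖J l φ‖ ≤ C * B := by
  induction l with
  | nil =>
    refine ⟨I0, fun {φ C} h => ?_⟩
    simp only [J]
    rw [norm_neg]
    calc _ ≤ ∫ v, C * (1 / √v) ∂mu := by
          apply norm_integral_le_of_norm_le (isq_int.const_mul _)
          exact ae_mu fun v hv => J0_pt h.2 hv
      _ = _ := by rw [integral_const_mul, I0]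
  | cons b l ih =>
    obtain ⟨B, hB⟩ := ih
    refine ⟨I0 * B, fun {φ C} h => ?_⟩
    rw [← mul_assoc]
    exact hB (Op_Cl b h)

theorem J_sc_int {H : ℝ → ℂ} (hH : H ∈ Fs) (l : List Bool) {x : ℝ} (hx : 0 < x) :
    Integrable (fun u => J l (sc H (u * x)) * ((1 / u : ℝ) : ℂ)) mu := by
  obtain ⟨C, hC⟩ := sc_Cl hH
  obtain ⟨B, hB⟩ := J_bound l
  apply J0_int (φ := fun u => J l (sc H (u * x))) (C := C * B * √x)
  constructor
  · apply J_meas l (Φ := fun u p => H (p * (u * x)))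
    exact hH.1.comp (f := fun a : ℝ × ℝ => a.2 * (a.1 * x)) (by fun_prop)
  · intro u hu
    have := hB (hC (u * x) (mul_pos hu.1 hx))
    rw [Real.sqrt_mul hu.1.le] at this
    calc _ ≤ _ := this
      _ = _ := by ring

variable (pr : Par G) (ds : DiamondSetup G)

def HQ (w : Ar G) (H : ℝ → ℂ) : Prop :=
  H ∈ Fs ∧ (∀ x > 0, FF pr w x = II H x) ∧ ∀ (l : List Bool) (s : G), ∀ x > 0,
    FF pr (ds.D s (vw l) w - Rs ds s (vw l) w) x =
      J (true :: l) (sc H x) - J (false :: l) (sc H x)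

theorem propA (w : Ar G) (H : ℝ → ℂ) (h : HQ pr ds w H) (l : List Bool) (s : G) : ∀ x > 0,
    FF pr (Rs ds s (vw l) w) x = J l (sc (Gt pr s w) x) := by
  obtain ⟨hH, hFH, hQ⟩ := h
  induction l with
  | nil =>
    intro x hx
    rw [vw, R_y1, FF_neg, FF_t, Pi.neg_apply, II_J _ hx, neg_neg]
  | cons b l ih =>
    cases b
    · intro x hx
      rw [vw, R_z, FF_z, J_false _ _ hx]
      exact II_of_J (Gt_mem pr s w) l ih hx
    · intro x hx
      rw [vw, R_x, FF_t]
      have ha := pr.hc s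
      set a := pr.c s with hadef
      have hF := FF_mem pr w
      have hK := Kf_mem ha (ep G w) hH hF
      have hG := Gt_mem pr s w
      have key : ∀ y > 0, Gt pr s (ds.D s (vw l) w) y =
          J (true :: l) (sc (Kf a (ep G w) H (FF pr w)) y) := by
        intro y hy
        obtain ⟨u, hu⟩ := vw_ends l
        have hep : ep G (ds.D s (vw l) w) = 0 := by rw [hu]; exact ep_D ds s u w
        have hD : FF pr (ds.D s (vw l) w) y = J l (sc (Gt pr s w) y) +
            J (true :: l) (sc H y) - J (false :: l) (sc H y) := by
          have e1 := hQ l s y hy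
          rw [FF_sub, Pi.sub_apply, ih y hy] at e1
          linear_combination e1
        obtain ⟨C1, h1⟩ := sc_Cl' hG hy
        obtain ⟨C2, h2⟩ := sc_Cl' hH hy
        obtain ⟨C3, h3⟩ := sc_Cl' hF hy
        have hJ3 : J (false :: l) (sc H y) = J l (sc (FF pr w) y) := by
          rw [J_false _ _ hy]
          apply J_congr
          intro p hp
          exact (hFH _ (mul_pos hp.1 hy)).symm
        have hsum : J l (sc (Gt pr s w) y) + J (true :: l) (sc H y) - J l (sc (FF pr w) y) =
            (1 + a * y) * J (true :: l) (sc (Kf a (ep G w) H (FF pr w)) y) := by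
          have hJt : ∀ φ, J (true :: l) φ = J l (Op true φ) := fun φ => rfl
          rw [hJt, hJt, ← J_smul, ← J_add l h1 (Op_Cl true h2)]
          have hm := J_smul l (φ := sc (FF pr w) y) (-1)
          rw [sub_eq_add_neg, ← neg_one_mul, ← hm,
            ← J_add l (Cl_add h1 (Op_Cl true h2)) (Cl_smul (-1) h3)]
          apply J_congr
          intro q hq
          rw [Kf_Op ha (ep G w) hH hF hFH hy hq]
          change _ = sc (Gt pr s w) y q + _ - _
          ring
        have hk2 := kp_ne ha hy
        have : Gt pr s (ds.D s (vw l) w) y = kp a y * FF pr (ds.D s (vw l) w) y := by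
          rw [Gt, hep]; simp [hadef]
        rw [this, hD, hJ3, hsum, kp, ← mul_assoc, one_div, inv_mul_cancel₀ hk2, one_mul]
      rw [II_of_J hK (true :: l) key hx]
      apply J_congr
      intro p hp
      exact Kf_II ha (ep G w) hH hF hFH _ (mul_pos hp.1 hx)

theorem exHQ (w : Ar G) : ∃ H, HQ pr ds w H := by
  let S : Submodule ℚ (Ar G) :=
    { carrier := {w | ∃ H, HQ pr ds w H}
      zero_mem' := by
        refine ⟨0, Fs.zero_mem, fun x hx => ?_, fun l s x hx => ?_⟩
        · rw [II_zero, FF, map_zero]; rfl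
        · have e : sc 0 x = 0 := rfl
          rw [e, J_zero, J_zero, map_zero, map_zero, sub_zero, FF, map_zero]; simp
      add_mem' := by
        rintro w w' ⟨H, h1, h2, h3⟩ ⟨H', h1', h2', h3'⟩
        refine ⟨H + H', Fs.add_mem h1 h1', fun x hx => ?_, fun l s x hx => ?_⟩
        · rw [FF_add, Pi.add_apply, h2 x hx, h2' x hx, II_add h1 h1']; rfl
        · rw [map_add, map_add, add_sub_add_comm, FF_add, Pi.add_apply, h3 l s x hx,
            h3' l s x hx]
          obtain ⟨C, hC⟩ := sc_Cl' h1 hx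
          obtain ⟨C', hC'⟩ := sc_Cl' h1' hx
          have e : ∀ l, J l (sc (H + H') x) = J l (sc H x) + J l (sc H' x) := fun l =>
            J_add l hC hC'
          rw [e, e]
          ring
      smul_mem' := by
        rintro a w ⟨H, h1, h2, h3⟩
        refine ⟨a • H, Fs.smul_mem a h1, fun x hx => ?_, fun l s x hx => ?_⟩
        · rw [FF_smul, Pi.smul_apply, h2 x hx, II_smul]; rfl
        · rw [map_smul, map_smul, ← smul_sub, FF_smul, Pi.smul_apply, h3 l s x hx, Rat.smul_def]
          have e : ∀ l, J l (sc (a • H) x) = a * J l (sc H x) := fun l =>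
            J_smul l (φ := sc H x) (a : ℂ)
          rw [e, e]
          ring }
  have : w ∈ S := by
    apply indL
    · refine ⟨0, Fs.zero_mem, fun x hx => ?_, fun l s x hx => ?_⟩
      · rw [II_zero, FF_one]
      · have e : sc 0 x = 0 := rfl
        rw [e, J_zero, J_zero, D_one', eh_sub_R, FF_qh]; simp
    · rintro w ⟨H, h1, h2, h3⟩
      refine ⟨FF pr w, FF_mem pr w, fun x hx => by rw [FF_z], fun l s x hx => ?_⟩
      rw [L3, FF_z]
      have e : ∀ x > 0, FF pr (ds.D s (vw l) w - Rs ds s (vw l) w) x =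
          (fun y => J (true :: l) (sc H y)) x - (fun y => J (false :: l) (sc H y)) x :=
        fun x hx => h3 l s x hx
      have e3 : ∀ l : List Bool, J l (sc (FF pr w) x) = J l (sc (II H) x) := fun l => by
        apply J_congr
        intro p hp
        exact h2 _ (mul_pos hp.1 hx)
      rw [e3, e3, ← J_II h1 _ hx, ← J_II h1 _ hx, II_pos _ hx, ← integral_sub]
      · apply integral_congr_ae
        refine ae_mu fun u hu => ?_
        simp only
        rw [h3 l s _ (mul_pos hu.1 hx)]
        ring
      · exact J_sc_int h1 _ hx
      · exact J_sc_int h1 _ hx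
    · rintro t w ⟨H, hH⟩
      have hA := propA pr ds w H hH
      refine ⟨Gt pr t w, Gt_mem pr t w, fun x hx => by rw [FF_t], fun l s x hx => ?_⟩
      have e1 := hA (true :: l) t x hx
      have e2 := hA (false :: l) t x hx
      simp only [vw] at e1 e2
      have hY : Y1 = Z1 - X1 := by rw [Z1]; abel
      rw [L4, sub_sub_cancel_left, FF_neg, hY, sub_mul, map_sub, LinearMap.sub_apply, FF_sub,
        Pi.neg_apply, Pi.sub_apply, e1, e2]
      ring
  exact this

end AQ
end RTM

namespace RTM
section Lim
open MeasureTheory Set Filter Topology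

theorem hop_true_le {q v : ℝ} (hq : q ∈ Ioo (0 : ℝ) 1) (hv : v ∈ Ioo (0 : ℝ) 1) :
    hop true q v ≤ √q * (1 / √v) := by
  simp only [hop]
  have hp : 0 < q + (1 - q) * v := (gop_mem true hq hv).1
  have hv0 := Real.sqrt_pos.mpr hv.1
  have hq0 := Real.sqrt_pos.mpr hq.1
  have h1 : √q * √v ≤ q + (1 - q) * v := by
    rw [← Real.sqrt_mul hq.1.le]
    apply Real.sqrt_le_iff.mpr
    refine ⟨hp.le, ?_⟩
    have h2 : q ≤ q + (1 - q) * v := by nlinarith [hq.2, hv.1]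
    have h3 : v ≤ q + (1 - q) * v := by nlinarith [hq.1, hv.2]
    nlinarith [hq.1, hv.1]
  calc q / (q + (1 - q) * v) ≤ q / (√q * √v) := by gcongr; exact hq.1.le
    _ = √q * (1 / √v) := by
      have := Real.sq_sqrt hq.1.le
      field_simp
      linarith

theorem Op_pt_bdd {φ : ℝ → ℂ} {C : ℝ} (hφ : ∀ p ∈ Ioo (0 : ℝ) 1, ‖φ p‖ ≤ C)
    {q v : ℝ} (hq : q ∈ Ioo (0 : ℝ) 1) (hv : v ∈ Ioo (0 : ℝ) 1) :
    ‖φ (gop true q v) * (hop true q v : ℂ)‖ ≤ C * √q * (1 / √v) := by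
  have h1 := hφ _ (gop_mem true hq hv)
  have hC : 0 ≤ C := (norm_nonneg _).trans h1
  rw [norm_mul, Complex.norm_real, Real.norm_of_nonneg (hop_nonneg true hq hv), mul_assoc]
  gcongr
  · exact hop_nonneg true hq hv
  · exact hop_true_le hq hv

theorem Op_Cl_bdd {φ : ℝ → ℂ} {C : ℝ} (hm : Measurable φ)
    (hφ : ∀ p ∈ Ioo (0 : ℝ) 1, ‖φ p‖ ≤ C) : Cl (Op true φ) (C * I0) := by
  constructor
  · have : StronglyMeasurable (Function.uncurry fun q v =>
        φ (gop true q v) * (hop true q v : ℂ)) := by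
      apply Measurable.stronglyMeasurable
      exact (hm.comp (meas_gop true)).mul (Complex.measurable_ofReal.comp (meas_hop true))
    exact (this.integral_prod_right (ν := mu)).measurable
  · intro q hq
    calc ‖Op true φ q‖ ≤ ∫ v, C * √q * (1 / √v) ∂mu := by
          apply norm_integral_le_of_norm_le (isq_int.const_mul _)
          exact ae_mu fun v hv => Op_pt_bdd hφ hq hv
      _ = C * I0 * √q := by rw [integral_const_mul, I0]; ring

theorem J_true_tendsto (l : List Bool) {g : ℝ → ℂ} (hm : Measurable g) {C : ℝ}
    (hb : ∀ x > 0, ‖g x‖ ≤ C) {e : ℂ} (hl : Tendsto g atTop (𝓝 e)) :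
    Tendsto (fun x => J (true :: l) (sc g x)) atTop (𝓝 (J (true :: l) fun _ => e)) := by
  simp only [J]
  have hmx : ∀ x, Measurable (sc g x) := fun x => hm.comp (measurable_id.mul_const x)
  have hbx : ∀ x > 0, ∀ p ∈ Ioo (0 : ℝ) 1, ‖sc g x p‖ ≤ C := fun x hx p hp =>
    hb _ (mul_pos hp.1 hx)
  apply J_tendsto l (C := C * I0)
  · filter_upwards [Ioi_mem_atTop (0 : ℝ)] with x hx
    exact Op_Cl_bdd (hmx x) (hbx x hx)
  · intro q hq
    simp only [Op]
    apply tendsto_integral_filter_of_dominated_convergence (fun v => C * √q * (1 / √v))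
    · exact Eventually.of_forall fun x => (Op_meas_q true (hmx x) q).aestronglyMeasurable
    · filter_upwards [Ioi_mem_atTop (0 : ℝ)] with x hx
      exact ae_mu fun p hp => Op_pt_bdd (hbx x hx) hq hp
    · exact isq_int.const_mul _
    · refine ae_mu fun v hv => Tendsto.mul_const _ ?_
      exact hl.comp (tendsto_id.const_mul_atTop (gop_mem true hq hv).1)

theorem kp_tendsto {a : ℂ} (ha : 0 < a.re) {F : ℝ → ℂ} (hF : F ∈ Fs) :
    Tendsto (fun x => kp a x * F x) atTop (𝓝 0) ∧ ∃ C, ∀ x > 0, ‖kp a x * F x‖ ≤ C := by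
  obtain ⟨_, _, C, h3⟩ := hF
  have hC : 0 ≤ C := by
    have := (norm_nonneg _).trans (h3 1 one_pos)
    simpa using this
  have hb : ∀ x > 0, ‖kp a x * F x‖ ≤ C / a.re * (1 / √x) := by
    intro x hx
    have hs := Real.sqrt_pos.mpr hx
    have hax := mul_pos ha hx
    rw [norm_mul]
    calc _ ≤ (1 / (1 + a.re * x)) * (C * √x) := by
          gcongr
          · exact kp_norm ha hx
          · exact h3 x hx
      _ ≤ (1 / (a.re * x)) * (C * √x) := by gcongr; linarith
      _ = _ := by
        have := Real.sq_sqrt hx.le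
        field_simp
        rw [this]
        ring
  constructor
  · apply squeeze_zero_norm' (a := fun x => C / a.re * (1 / √x))
    · filter_upwards [Ioi_mem_atTop (0 : ℝ)] with x hx
      exact hb x hx
    · have : Tendsto (fun x : ℝ => 1 / √x) atTop (𝓝 0) := by
        simp only [one_div]
        exact tendsto_inv_atTop_zero.comp Real.tendsto_sqrt_atTop
      simpa using this.const_mul (C / a.re)
  · refine ⟨max C (C / a.re), fun x hx => ?_⟩
    rcases le_total x 1 with h | h
    · refine le_trans ?_ (le_max_left _ _)
      rw [norm_mul]
      calc _ ≤ 1 * (C * √x) := by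
            gcongr
            · exact kp_le_one ha hx
            · exact h3 x hx
        _ ≤ 1 * (C * 1) := by
            gcongr
            exact Real.sqrt_le_one.mpr h
        _ = C := by ring
    · refine le_trans (hb x hx) (le_trans ?_ (le_max_right _ _))
      have : 1 / √x ≤ 1 := by
        rw [div_le_one (Real.sqrt_pos.mpr hx)]
        exact Real.one_le_sqrt.mpr h
      calc _ ≤ C / a.re * 1 := by gcongr
        _ = _ := mul_one _

theorem kp_lim {a : ℂ} (ha : 0 < a.re) : Tendsto (kp a) atTop (𝓝 0) := by
  apply squeeze_zero_norm' (a := fun x => 1 / (1 + a.re * x))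
  · filter_upwards [Ioi_mem_atTop (0 : ℝ)] with x hx
    exact kp_norm ha hx
  · simp only [one_div]
    apply tendsto_inv_atTop_zero.comp
    apply tendsto_atTop_add_const_left
    exact tendsto_id.const_mul_atTop ha

variable (pr : Par G) (ds : DiamondSetup G)

theorem limA (w : Ar G) (l : List Bool) (s : G) :
    Tendsto (FF pr (zdel s * ds.D s (vw l) w)) atTop
      (𝓝 (J (true :: l) fun _ => -(ep G w : ℂ))) := by
  obtain ⟨H, hH⟩ := exHQ pr ds w
  have h := propA pr ds w H hH (true :: l) s
  simp only [vw, R_x] at h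
  obtain ⟨t1, C, hC⟩ := kp_tendsto (pr.hc s) (FF_mem pr w)
  have hg : Tendsto (Gt pr s w) atTop (𝓝 (-(ep G w : ℂ))) := by
    have := t1.add (((kp_lim (pr.hc s)).sub_const 1).const_mul (ep G w : ℂ))
    rw [zero_sub, mul_neg, mul_one, zero_add] at this
    exact this
  have hb : ∀ x > 0, ‖Gt pr s w x‖ ≤ C + ‖(ep G w : ℂ)‖ * 2 := by
    intro x hx
    refine (norm_add_le _ _).trans (add_le_add (hC x hx) ?_)
    rw [norm_mul]
    gcongr
    calc _ ≤ ‖kp (pr.c s) x‖ + ‖(1 : ℂ)‖ := norm_sub_le _ _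
      _ ≤ 1 + 1 := by
        rw [norm_one]
        gcongr
        exact kp_le_one (pr.hc s) hx
      _ = 2 := by norm_num
  refine (J_true_tendsto l (Gt_mem pr s w).1 hb hg).congr' ?_
  filter_upwards [Ioi_mem_atTop (0 : ℝ)] with x hx
  exact (h x hx).symm

theorem vw_span (u : A1) : u * Y1 ∈ Submodule.span ℚ (Set.range vw) := by
  let S : Submodule ℚ A1 := (Submodule.span ℚ (Set.range vw)).comap (LinearMap.mulRight ℚ Y1)
  have hl : ∀ (b : Bool) (a : A1), (∀ l, a * vw l = vw (b :: l)) →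
      ∀ w ∈ Submodule.span ℚ (Set.range vw), a * w ∈ Submodule.span ℚ (Set.range vw) := by
    intro b a ha w hw
    induction hw using Submodule.span_induction with
    | mem w h =>
      obtain ⟨l, rfl⟩ := h
      exact Submodule.subset_span ⟨b :: l, (ha l).symm⟩
    | zero => rw [mul_zero]; exact Submodule.zero_mem _
    | add x y _ _ hx hy => rw [mul_add]; exact Submodule.add_mem _ hx hy
    | smul c x _ hx => rw [mul_smul_comm]; exact Submodule.smul_mem _ c hx
  have : u ∈ S := by
    apply indL1z
    · change 1 * Y1 ∈ Submodule.span ℚ (Set.range vw)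
      exact Submodule.subset_span ⟨[], by simp [vw]⟩
    · intro w hw
      change X1 * w * Y1 ∈ Submodule.span ℚ (Set.range vw)
      rw [mul_assoc]
      exact hl true X1 (fun l => rfl) _ hw
    · intro w hw
      change Z1 * w * Y1 ∈ Submodule.span ℚ (Set.range vw)
      rw [mul_assoc]
      exact hl false Z1 (fun l => rfl) _ hw
  exact this

/-- the main limit statement: a limit that depends only on `ε(w)` -/
theorem limB (u : A1) : ∃ m : ℂ, ∀ (w : Ar G) (s : G),
    Tendsto (FF pr (zdel s * ds.D s (u * Y1) w)) atTop (𝓝 ((ep G w : ℂ) * m)) := by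
  have h := vw_span u
  generalize u * Y1 = v at h
  induction h using Submodule.span_induction with
  | mem v h =>
    obtain ⟨l, rfl⟩ := h
    refine ⟨J (true :: l) fun _ => -1, fun w s => ?_⟩
    have := limA pr ds w l s
    rw [← J_smul]
    simpa using this
  | zero =>
    refine ⟨0, fun w s => ?_⟩
    have e : FF pr (zdel s * ds.D s 0 w) = fun _ => 0 := by
      rw [map_zero, LinearMap.zero_apply, mul_zero, FF, map_zero]; rfl
    rw [e, mul_zero]
    exact tendsto_const_nhds
  | add x y _ _ hx hy =>
    obtain ⟨m, hm⟩ := hx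
    obtain ⟨m', hm'⟩ := hy
    refine ⟨m + m', fun w s => ?_⟩
    rw [map_add, LinearMap.add_apply, mul_add, FF_add, mul_add]
    exact (hm w s).add (hm' w s)
  | smul c x _ hx =>
    obtain ⟨m, hm⟩ := hx
    refine ⟨c * m, fun w s => ?_⟩
    rw [map_smul, LinearMap.smul_apply, mul_smul_comm, FF_smul]
    have := (hm w s).const_mul (c : ℂ)
    have e : c • FF pr (zdel s * ds.D s x w) =
        fun y => (c : ℂ) * FF pr (zdel s * ds.D s x w) y := by
      funext y; simp [Rat.smul_def]
    rw [e]
    convert this using 2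
    ring

end Lim
end RTM

namespace RTM
section PS
open MeasureTheory Set Filter Topology

noncomputable def Ps (a : ℕ → ℂ) (t : ℝ) : ℂ := ∑' n, a n * (t : ℂ) ^ n

theorem ps_norm {a : ℕ → ℂ} (ha : ∀ n, ‖a n‖ ≤ 1) {t : ℝ} (ht : |t| < 1) :
    Summable fun n => ‖a n * (t : ℂ) ^ n‖ := by
  refine Summable.of_nonneg_of_le (fun n => norm_nonneg _) (fun n => ?_)
    (summable_geometric_of_lt_one (abs_nonneg t) ht)
  rw [norm_mul, norm_pow, Complex.norm_real, Real.norm_eq_abs]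
  calc _ ≤ 1 * |t| ^ n := by gcongr; exact ha n
    _ = _ := one_mul _

theorem ps_deriv {b : ℕ → ℂ} (hb : ∀ n, ‖b n‖ ≤ 1) {t : ℝ} (ht : |t| < 1) :
    HasDerivAt (Ps b) (∑' n, b n * (n * (t : ℂ) ^ (n - 1))) t := by
  obtain ⟨ρ, h1, h2⟩ := exists_between ht
  have hρ : 0 < ρ := (abs_nonneg t).trans_lt h1
  have hu : Summable (fun n : ℕ => (n : ℝ) * ρ ^ (n - 1)) := by
    have h := summable_pow_mul_geometric_of_norm_lt_one (R := ℝ) 1 (r := ρ)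
      (by rw [Real.norm_of_nonneg hρ.le]; exact h2)
    have h' := h.mul_right ρ⁻¹
    refine h'.congr fun n => ?_
    cases n with
    | zero => simp
    | succ n =>
      simp only [Nat.add_sub_cancel, pow_one, pow_succ]
      field_simp
  unfold Ps
  refine hasDerivAt_tsum_of_isPreconnected (u := fun n : ℕ => (n : ℝ) * ρ ^ (n - 1))
    (g := fun n (y : ℝ) => b n * (y : ℂ) ^ n) (g' := fun n (y : ℝ) => b n * (n * (y : ℂ) ^ (n - 1)))
    (t := Ioo (-ρ) ρ) (y₀ := 0) hu isOpen_Ioo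
    isPreconnected_Ioo ?_ ?_ ?_ ?_ (abs_lt.mp h1)
  · intro n y _
    have := ((hasDerivAt_id y).ofReal_comp.pow n).const_mul (b n)
    simpa using this
  · intro n y hy
    have hy' : |y| ≤ ρ := (abs_lt.mpr hy).le
    simp only [norm_mul, norm_pow, Complex.norm_real, Real.norm_eq_abs, Complex.norm_natCast]
    calc _ ≤ 1 * ((n : ℝ) * ρ ^ (n - 1)) := by
          gcongr
          exact hb n
      _ = _ := one_mul _
  · exact ⟨by linarith, hρ⟩
  · have := (ps_norm hb (t := 0) (by simp)).of_norm
    exact this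

theorem ps_zero (b : ℕ → ℂ) : Ps b 0 = b 0 := by
  rw [Ps, tsum_eq_single 0]
  · simp
  · intro n hn
    simp [hn]

/-- the change of variable `t = x/(1+x)` -/
noncomputable def tv (x : ℝ) : ℝ := x / (1 + x)

theorem tv_mem {x : ℝ} (hx : 0 < x) : 0 < tv x ∧ tv x < 1 := by
  rw [tv]
  refine ⟨by positivity, ?_⟩
  rw [div_lt_one (by linarith)]
  linarith

theorem tv_abs {x : ℝ} (hx : 0 < x) : |tv x| < 1 := by
  rw [abs_of_pos (tv_mem hx).1]; exact (tv_mem hx).2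

theorem tv_deriv {x : ℝ} (hx : 0 < x) : HasDerivAt tv (1 / (1 + x) ^ 2) x := by
  have h := (hasDerivAt_id x).div ((hasDerivAt_id x).const_add 1) (by simp; linarith)
  have e : (1 / (1 + x) ^ 2 : ℝ) = (1 * (1 + id x) - id x * 1) / (1 + id x) ^ 2 := by
    simp
  rw [e]
  exact h

theorem tv_zero : Tendsto tv (𝓝[>] 0) (𝓝 0) := by
  have : ContinuousAt tv 0 := by
    unfold tv
    apply ContinuousAt.div continuousAt_id (by fun_prop)
    simp
  have h := this.tendsto
  have e : tv 0 = 0 := by simp [tv]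
  rw [e] at h
  exact h.mono_left nhdsWithin_le_nhds

theorem tv_top : Tendsto tv atTop (𝓝[<] 1) := by
  refine tendsto_nhdsWithin_iff.mpr ⟨?_, ?_⟩
  · have h : Tendsto (fun x : ℝ => 1 - (1 + x)⁻¹) atTop (𝓝 (1 - 0)) := by
      apply Tendsto.const_sub
      apply tendsto_inv_atTop_zero.comp
      exact tendsto_atTop_add_const_left _ _ tendsto_id
    rw [sub_zero] at h
    refine h.congr' ?_
    filter_upwards [Ioi_mem_atTop (0 : ℝ)] with x hx
    have : (1 + x) ≠ 0 := by have : 0 < x := hx; linarith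
    rw [tv]
    field_simp
    ring
  · filter_upwards [Ioi_mem_atTop (0 : ℝ)] with x hx
    exact (tv_mem hx).2

theorem II_ps {b : ℕ → ℂ} (hb : ∀ n, ‖b n‖ ≤ 1) (hb0 : b 0 = 0) {K : ℝ → ℂ} (hK : K ∈ Fs)
    (h : ∀ x > 0, (∑' n, b n * (n * (tv x : ℂ) ^ (n - 1))) * (1 / (1 + x) ^ 2) = K x / x) :
    ∀ x > 0, II K x = Ps b (tv x) := by
  apply II_unique hK (g := fun x => Ps b (tv x))
  · intro x hx
    have := (ps_deriv hb (tv_abs hx)).scomp x (tv_deriv hx)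
    rw [← h x hx]
    have e2 : (∑' n, b n * (n * (tv x : ℂ) ^ (n - 1))) * (1 / (1 + (x : ℂ)) ^ 2) =
        (1 / (1 + x) ^ 2 : ℝ) • (∑' n, b n * (n * (tv x : ℂ) ^ (n - 1))) := by
      rw [Complex.real_smul]
      push_cast
      ring
    rw [e2]
    exact this
  · have hc : ContinuousAt (Ps b) 0 := (ps_deriv hb (t := 0) (by simp)).continuousAt
    have := hc.tendsto
    rw [ps_zero, hb0] at this
    exact this.comp tv_zero

variable (pr : Par G) (om : G → ℂ)

/-- `w` is represented by the coefficient sequence `a`. -/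
def Repr (w : Ar G) (a : ℕ → ℂ) : Prop :=
  (ep G w : ℂ) = a 0 ∧ (∀ n, ‖a n‖ ≤ 1) ∧ ∀ x > 0, FF pr w x + a 0 = Ps a (tv x)

theorem repr_one : Repr pr 1 (fun n => if n = 0 then 1 else 0) := by
  refine ⟨by simp, fun n => by simp only; split_ifs <;> simp, fun x hx => ?_⟩
  rw [FF_one, Ps, tsum_eq_single 0]
  · simp
  · intro n hn; simp [hn]

theorem repr_X (hc1 : pr.c 1 = 1) {w : Ar G} {a : ℕ → ℂ} (h : Repr pr w a) (h0 : a 0 = 0) :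
    Repr pr (Xr * w) (fun n => a n / n) := by
  obtain ⟨h1, h2, h3⟩ := h
  have hbb : ∀ n, ‖a n / n‖ ≤ 1 := by
    intro n
    rcases Nat.eq_zero_or_pos n with rfl | hn
    · simp
    · rw [norm_div, Complex.norm_natCast]
      have : (1 : ℝ) ≤ n := by exact_mod_cast hn
      rw [div_le_one (by linarith)]
      exact (h2 n).trans this
  refine ⟨by simp [ep_X], hbb, fun x hx => ?_⟩
  simp only [Nat.cast_zero, div_zero, add_zero]
  rw [← zdel_one, FF_t]
  apply II_ps hbb (by simp) (Gt_mem pr 1 w) ?_ x hx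
  intro x hx
  have ht := tv_mem hx
  have hx0 : (x : ℂ) ≠ 0 := by exact_mod_cast hx.ne'
  have hx1 : (1 + x : ℂ) ≠ 0 := by
    have : (1 + x : ℝ) ≠ 0 := by positivity
    exact_mod_cast this
  have htx : (tv x : ℂ) = x / (1 + x) := by rw [tv]; push_cast; rfl
  have hA := h3 x hx
  rw [h0, add_zero] at hA
  have e : (tv x : ℂ) * ∑' n, a n / n * (n * (tv x : ℂ) ^ (n - 1)) = Ps a (tv x) := by
    rw [← tsum_mul_left, Ps]
    congr 1
    funext n
    cases n with
    | zero => simp [h0]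
    | succ n =>
      have : ((n + 1 : ℕ) : ℂ) ≠ 0 := by exact_mod_cast Nat.succ_ne_zero n
      rw [Nat.add_sub_cancel, pow_succ]
      field_simp
  have hg : Gt pr 1 w x = 1 / (1 + x) * Ps a (tv x) := by
    rw [Gt, h1, h0, hc1, hA, kp]; ring
  rw [hg, ← e, htx]
  field_simp

theorem repr_Y (hc1 : pr.c 1 = 1) (hcs : ∀ s, s ≠ 1 → pr.c s = 1 - om s) (ho : om 1 = 1)
    (hn : ∀ s, ‖om s‖ ≤ 1) (s : G)
    {w : Ar G} {a : ℕ → ℂ} (h : Repr pr w a) :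
    Repr pr (Yr s * w) (fun n => (∑ j ∈ Finset.range n, om s ^ (n - j) * a j) / n) := by
  obtain ⟨h1, h2, h3⟩ := h
  have hbb : ∀ n : ℕ, ‖(∑ j ∈ Finset.range n, om s ^ (n - j) * a j) / (n : ℂ)‖ ≤ 1 := by
    intro n
    rcases Nat.eq_zero_or_pos n with rfl | hn'
    · simp
    · rw [norm_div, Complex.norm_natCast]
      have : (1 : ℝ) ≤ n := by exact_mod_cast hn'
      rw [div_le_one (by linarith)]
      refine (norm_sum_le _ _).trans ?_
      calc _ ≤ ∑ j ∈ Finset.range n, (1 : ℝ) := by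
            apply Finset.sum_le_sum
            intro j _
            rw [norm_mul, norm_pow]
            exact mul_le_one₀ (pow_le_one₀ (norm_nonneg _) (hn s)) (norm_nonneg _) (h2 j)
        _ = n := by simp
  refine ⟨by simp [ep_Y], hbb, fun x hx => ?_⟩
  simp only [Nat.cast_zero, div_zero, add_zero]
  -- the function
  have hE : ∃ K ∈ Fs, FF pr (Yr s * w) = II K ∧ ∀ x : ℝ, 0 < x → (1 + (1 - om s) * (x : ℂ)) ≠ 0 ∧
      K x = (1 / (1 + (1 - om s) * x) - 1 / (1 + x)) * (FF pr w x + a 0) := by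
    by_cases hs : s = 1
    · subst hs
      refine ⟨FF pr w - Gt pr 1 w, Fs.sub_mem (FF_mem pr w) (Gt_mem pr 1 w), ?_, ?_⟩
      · have : (Yr 1 : Ar G) = zet - zdel 1 := by rw [zdel_one, zet]; abel
        rw [this, sub_mul, FF_sub, FF_z, FF_t]
        have e := II_add (Fs.sub_mem (FF_mem pr w) (Gt_mem pr 1 w)) (Gt_mem pr 1 w)
        rw [sub_add_cancel] at e
        rw [e, add_sub_cancel_right]
      · intro x hx
        refine ⟨by rw [ho]; simp, ?_⟩
        rw [Pi.sub_apply, Gt, h1, hc1, ho, kp]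
        ring
    · refine ⟨Gt pr s w - Gt pr 1 w, Fs.sub_mem (Gt_mem pr s w) (Gt_mem pr 1 w), ?_, ?_⟩
      · have : (Yr s : Ar G) = zdel s - zdel 1 := by rw [zdel_one, zdel, if_neg hs]; abel
        rw [this, sub_mul, FF_sub, FF_t, FF_t]
        have e := II_add (Fs.sub_mem (Gt_mem pr s w) (Gt_mem pr 1 w)) (Gt_mem pr 1 w)
        rw [sub_add_cancel] at e
        rw [e, add_sub_cancel_right]
      · intro x hx
        have := kp_ne (pr.hc s) hx
        rw [hcs s hs] at this
        refine ⟨this, ?_⟩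
        rw [Pi.sub_apply, Gt, Gt, h1, hc1, hcs s hs, kp, kp]
        ring
  obtain ⟨K, hK, hFK, hKx⟩ := hE
  rw [hFK]
  apply II_ps hbb (by simp) hK ?_ x hx
  intro x hx
  have ht := tv_mem hx
  have hx0 : (x : ℂ) ≠ 0 := by exact_mod_cast hx.ne'
  have hx1 : (1 + x : ℂ) ≠ 0 := by
    have : (1 + x : ℝ) ≠ 0 := by positivity
    exact_mod_cast this
  have htx : (tv x : ℂ) = x / (1 + x) := by rw [tv]; push_cast; rfl
  obtain ⟨hne, hKe⟩ := hKx x hx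
  have hlt : ‖om s * (tv x : ℂ)‖ < 1 := by
    rw [norm_mul, Complex.norm_real, Real.norm_of_nonneg ht.1.le]
    calc _ ≤ 1 * tv x := by gcongr; exact ht.1.le; exact hn s
      _ < 1 := by rw [one_mul]; exact ht.2
  have e : ∑' n : ℕ, (∑ j ∈ Finset.range n, om s ^ (n - j) * a j) / (n : ℂ) *
      (n * (tv x : ℂ) ^ (n - 1)) = om s * (Ps a (tv x) * (1 - om s * tv x)⁻¹) := by
    rw [← tsum_geometric_of_norm_lt_one hlt, Ps,
      tsum_mul_tsum_eq_tsum_sum_range_of_summable_norm (ps_norm h2 (tv_abs hx))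
        (by
          simp only [norm_pow]
          exact summable_geometric_of_lt_one (norm_nonneg _) hlt), ← tsum_mul_left]
    rw [← Function.Injective.tsum_eq Nat.succ_injective]
    · congr 1
      funext n
      have hn0 : ((n + 1 : ℕ) : ℂ) ≠ 0 := by exact_mod_cast Nat.succ_ne_zero n
      simp only [Nat.succ_eq_add_one, Nat.add_sub_cancel]
      rw [div_mul_eq_mul_div, mul_left_comm, mul_div_cancel_left₀ _ hn0, Finset.mul_sum,
        Finset.sum_mul]
      refine Finset.sum_congr rfl fun j hj => ?_
      obtain ⟨d, rfl⟩ := Nat.exists_eq_add_of_le (Nat.lt_succ_iff.mp (Finset.mem_range.mp hj))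
      rw [show j + d + 1 - j = d + 1 by omega, show j + d - j = d by omega]
      ring
    · intro n hn'
      rcases n with _ | n
      · simp at hn'
      · exact ⟨n, rfl⟩
  rw [e, hKe, h3 x hx, htx]
  have h5 : (1 - om s * (x / (1 + x)) : ℂ) = (1 + (1 - om s) * x) / (1 + x) := by
    field_simp; ring
  rw [h5]
  field_simp
  ring

end PS
end RTM

namespace RTM
section Sums
open Set Filter Topology

variable (om : G → ℂ)

/-- coefficients of the multiple polylogarithm attached to a word -/
noncomputable def cf : List (ℕ × G) → ℕ → ℂ
  | [] => fun n => if n = 0 then 1 else 0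
  | p :: L => fun n => (∑ j ∈ Finset.range n, om p.2 ^ (n - j) * cf L j) / (n : ℂ) ^ (p.1 + 1)

theorem cf_repr (pr : Par G) (hc1 : pr.c 1 = 1) (hcs : ∀ s, s ≠ 1 → pr.c s = 1 - om s)
    (ho : om 1 = 1) (hn : ∀ s, ‖om s‖ ≤ 1) (L : List (ℕ × G)) :
    Repr pr (wordP L) (cf om L) := by
  induction L with
  | nil =>
    have : (wordP ([] : List (ℕ × G))) = 1 := by simp [wordP]
    rw [this]
    exact repr_one pr
  | cons p L ih =>
    obtain ⟨a, s⟩ := p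
    rw [wordP_cons, mul_assoc]
    induction a with
    | zero =>
      have := repr_Y pr om hc1 hcs ho hn s ih
      simpa [cf] using this
    | succ a iha =>
      have := repr_X pr hc1 iha (by simp [cf])
      rw [pow_succ', mul_assoc]
      have e : cf om ((a + 1, s) :: L) = fun n => cf om ((a, s) :: L) n / n := by
        funext n
        simp only [cf]
        rw [div_div, ← pow_succ]
      rw [e]
      exact this

/-- first entry (or zero) -/
def hd {l : ℕ} (g : Fin l → ℕ) : ℕ := if h : 0 < l then g ⟨0, h⟩ else 0

open scoped Classical in
/-- strictly decreasing positive tuples below `M` -/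
noncomputable def St (l M : ℕ) : Finset (Fin l → ℕ) :=
  (Fintype.piFinset fun _ => Finset.range M).filter
    (fun g => (∀ i j : Fin l, i < j → g j < g i) ∧ ∀ i : Fin l, 0 < g i)

/-- the summand -/
noncomputable def tm {l : ℕ} (k : Fin l → ℕ) (s : Fin l → G) (g : Fin l → ℕ) : ℂ :=
  (∏ i : Fin l, om (s i) ^ (g i - (if h : (i : ℕ) + 1 < l then g ⟨(i : ℕ) + 1, h⟩ else 0)))
      / (∏ i : Fin l, ((g i : ℕ) : ℂ) ^ (k i))

theorem mem_St {l M : ℕ} {g : Fin l → ℕ} : g ∈ St l M ↔ (∀ i, g i < M) ∧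
    (∀ i j : Fin l, i < j → g j < g i) ∧ ∀ i : Fin l, 0 < g i := by
  simp [St, Fintype.mem_piFinset]

theorem mem_St_cons {l M n : ℕ} {g : Fin l → ℕ} : (Fin.cons n g : Fin (l + 1) → ℕ) ∈ St (l + 1) M ↔
    (n < M ∧ 0 < n) ∧ g ∈ St l n := by
  rw [mem_St, mem_St]
  constructor
  · rintro ⟨h1, h2, h3⟩
    refine ⟨⟨by simpa using h1 0, by simpa using h3 0⟩, fun i => ?_, fun i j hij => ?_, fun i => ?_⟩
    · simpa using h2 0 i.succ (Fin.succ_pos i)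
    · simpa using h2 i.succ j.succ (Fin.succ_lt_succ_iff.mpr hij)
    · simpa using h3 i.succ
  · rintro ⟨⟨h1, h2⟩, h3, h4, h5⟩
    refine ⟨fun i => ?_, fun i j hij => ?_, fun i => ?_⟩
    · refine Fin.cases ?_ (fun i => ?_) i
      · simpa using h1
      · simpa using (h3 i).trans h1
    · induction j using Fin.cases with
      | zero => exact absurd hij (Fin.not_lt_zero i)
      | succ j =>
        induction i using Fin.cases with
        | zero => simpa using h3 j
        | succ i => simpa using h4 i j (Fin.succ_lt_succ_iff.mp hij)
    · refine Fin.cases ?_ (fun i => ?_) i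
      · simpa using h2
      · simpa using h5 i

theorem tm_cons {l n : ℕ} (k : Fin (l + 1) → ℕ) (s : Fin (l + 1) → G) (g : Fin l → ℕ) :
    tm om k s (Fin.cons n g : Fin (l + 1) → ℕ) = om (s 0) ^ (n - hd g) / (n : ℂ) ^ (k 0) *
      tm om (fun i => k i.succ) (fun i => s i.succ) g := by
  unfold tm
  rw [Fin.prod_univ_succ, Fin.prod_univ_succ, div_mul_div_comm]
  congr 1
  congr 1
  · congr 2
    rw [hd]
    by_cases h : 0 < l
    · rw [dif_pos h, dif_pos (by simpa using h)]
      exact Fin.cons_succ (α := fun _ => ℕ) n g ⟨0, h⟩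
    · rw [dif_neg h, dif_neg (by simpa using h)]
  · refine Finset.prod_congr rfl fun i _ => ?_
    congr 2
    by_cases h : (i : ℕ) + 1 < l
    · rw [dif_pos h, dif_pos (by simpa using h)]
      exact Fin.cons_succ (α := fun _ => ℕ) n g ⟨i + 1, h⟩
    · rw [dif_neg h, dif_neg (by simpa using h)]

theorem sum_St (l : ℕ) : ∀ (k : Fin l → ℕ) (s : Fin l → G) (_ : ∀ i, 1 ≤ k i) (M : ℕ) (φ : ℕ → ℂ),
    0 < M → ∑ g ∈ St l M, φ (hd g) * tm om k s g =
      ∑ j ∈ Finset.range M, φ j * cf om (List.ofFn fun i => (k i - 1, s i)) j := by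
  induction l with
  | zero =>
    intro k s _ M φ hM
    have e : St 0 M = {Fin.elim0} := by
      ext g
      rw [mem_St]
      constructor
      · intro _
        rw [Finset.mem_singleton]
        exact Subsingleton.elim _ _
      · intro _
        exact ⟨fun i => i.elim0, fun i => i.elim0, fun i => i.elim0⟩
    rw [e, Finset.sum_singleton]
    rw [Finset.sum_eq_single 0]
    · simp [hd, tm, cf]
    · intro b _ hb
      simp [cf, hb]
    · intro h
      exact absurd (Finset.mem_range.mpr hM) h
  | succ l ih =>
    intro k s hk M φ hM
    have e : ∑ g ∈ St (l + 1) M, φ (hd g) * tm om k s g =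
        ∑ n ∈ (Finset.range M).filter (fun n => 0 < n), ∑ g ∈ St l n,
          φ n * tm om k s (Fin.cons n g : Fin (l + 1) → ℕ) := by
      rw [Finset.sum_sigma']
      refine Finset.sum_bij' (fun g _ => ⟨g 0, Fin.tail g⟩)
        (fun p _ => (Fin.cons p.1 p.2 : Fin (l + 1) → ℕ)) ?_ ?_ ?_ ?_ ?_
      · intro g hg
        rw [← Fin.cons_self_tail g, mem_St_cons] at hg
        simp only [Finset.mem_sigma, Finset.mem_filter, Finset.mem_range]
        exact hg
      · rintro ⟨n, g⟩ hg
        simp only [Finset.mem_sigma, Finset.mem_filter, Finset.mem_range] at hg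
        exact mem_St_cons.mpr hg
      · intro g _
        exact Fin.cons_self_tail g
      · rintro ⟨n, g⟩ _
        rfl
      · intro g _
        simp only [Fin.cons_self_tail]
        congr 1
    rw [e]
    have e0 : ∑ j ∈ Finset.range M, φ j * cf om (List.ofFn fun i => (k i - 1, s i)) j =
        ∑ j ∈ (Finset.range M).filter (fun n => 0 < n),
          φ j * cf om (List.ofFn fun i => (k i - 1, s i)) j := by
      symm
      apply Finset.sum_filter_of_ne
      intro n _ h
      rcases Nat.eq_zero_or_pos n with rfl | h'
      · exfalso
        apply h
        rw [List.ofFn_succ]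
        simp [cf]
      · exact h'
    rw [e0]
    refine Finset.sum_congr rfl fun n hn => ?_
    have hn0 : 0 < n := (Finset.mem_filter.mp hn).2
    have h := ih (fun i => k i.succ) (fun i => s i.succ) (fun i => hk i.succ) n
      (fun j => om (s 0) ^ (n - j)) hn0
    rw [List.ofFn_succ]
    simp only [cf]
    rw [← h, Nat.sub_add_cancel (hk 0), ← Finset.mul_sum, Finset.sum_div]
    congr 1
    refine Finset.sum_congr rfl fun g _ => ?_
    rw [tm_cons]
    ring

end Sums

section Final
open Set Filter Topology

variable {r : ℕ}

/-- the inclusion of the roots of unity -/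
noncomputable def omr (s : rootsOfUnity r ℂ) : ℂ := ((s : ℂˣ) : ℂ)

theorem plSum_eq (l : ℕ) (k : Fin l → ℕ) (s : Fin l → rootsOfUnity r ℂ) (hk : ∀ i, 1 ≤ k i)
    (M : ℕ) (hM : 0 < M) : plSum r l k s M =
      ∑ j ∈ Finset.range M, cf omr (List.ofFn fun i => (k i - 1, s i)) j := by
  have h := sum_St omr l k s hk M (fun _ => 1) hM
  simp only [one_mul] at h
  rw [← h, plSum]
  refine Finset.sum_bij' (fun g _ => fun i => (g i : ℕ))
    (fun g hg => fun i => ⟨g i, (mem_St.mp hg).1 i⟩) ?_ ?_ ?_ ?_ ?_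
  · intro g hg
    rw [Finset.mem_filter] at hg
    exact mem_St.mpr ⟨fun i => (g i).2, hg.2⟩
  · intro g hg
    rw [Finset.mem_filter]
    exact ⟨Finset.mem_univ _, (mem_St.mp hg).2⟩
  · intro g _
    rfl
  · intro g _
    rfl
  · intro g _
    rfl

theorem lim_word (pr : Par (rootsOfUnity r ℂ)) (hc1 : pr.c 1 = 1)
    (hcs : ∀ s, s ≠ 1 → pr.c s = 1 - omr s) (hn : ∀ s : rootsOfUnity r ℂ, ‖omr s‖ ≤ 1)
    (l : ℕ) (hl : 0 < l) (k : Fin l → ℕ) (s : Fin l → rootsOfUnity r ℂ) (hk : ∀ i, 1 ≤ k i)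
    (z : ℂ) (hz : Tendsto (plSum r l k s) atTop (𝓝 z)) :
    Tendsto (FF pr (wAdm l k s)) atTop (𝓝 z) := by
  set Lw := List.ofFn fun i => (k i - 1, s i) with hLw
  obtain ⟨h1, h2, h3⟩ := cf_repr omr pr hc1 hcs (by simp [omr]) hn Lw
  have h0 : cf omr Lw 0 = 0 := by
    obtain ⟨l, rfl⟩ := Nat.exists_eq_succ_of_ne_zero hl.ne'
    rw [hLw, List.ofFn_succ]
    simp [cf]
  have hA : Tendsto (fun n => ∑ i ∈ Finset.range n, cf omr Lw i) atTop (𝓝 z) := by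
    refine hz.congr' ?_
    filter_upwards [Ioi_mem_atTop 0] with M hM
    exact plSum_eq l k s hk M hM
  have hB := Complex.tendsto_tsum_powerSeries_nhdsWithin_lt hA
  rw [tendsto_map'_iff] at hB
  have hC := hB.comp tv_top
  rw [wAdm_eq]
  refine hC.congr' ?_
  filter_upwards [Ioi_mem_atTop (0 : ℝ)] with x hx
  have := h3 x hx
  rw [h0, add_zero] at this
  rw [this]
  rfl

theorem lim_A0 (pr : Par (rootsOfUnity r ℂ)) (hc1 : pr.c 1 = 1)
    (hcs : ∀ s, s ≠ 1 → pr.c s = 1 - omr s) (hn : ∀ s : rootsOfUnity r ℂ, ‖omr s‖ ≤ 1)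
    (L : Ar (rootsOfUnity r ℂ) →ₗ[ℚ] ℂ)
    (hLspec : ∀ (l : ℕ) (hl : 0 < l) (k : Fin l → ℕ) (s : Fin l → (rootsOfUnity r ℂ)),
      (∀ i, 1 ≤ k i) → (2 ≤ k ⟨0, hl⟩ ∨ s ⟨0, hl⟩ ≠ 1) →
      Filter.Tendsto (plSum r l k s) Filter.atTop (nhds (L (wAdm l k s))))
    (a : Ar (rootsOfUnity r ℂ)) (ha : a ∈ A0plus (rootsOfUnity r ℂ)) :
    Tendsto (FF pr a) atTop (𝓝 (L a)) := by
  rw [A0plus] at ha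
  induction ha using Submodule.span_induction with
  | mem x hx =>
    obtain ⟨l, hl, k, s, hk, h, rfl⟩ := hx
    exact lim_word pr hc1 hcs hn l hl k s hk _ (hLspec l hl k s hk h)
  | zero =>
    have : FF pr (0 : Ar (rootsOfUnity r ℂ)) = 0 := by
      have := FF_smul pr 0 (1 : Ar (rootsOfUnity r ℂ))
      rw [zero_smul] at this
      rw [this]
      funext x
      simp [sc]
    rw [this, map_zero]
    exact tendsto_const_nhds
  | add x y _ _ hx hy =>
    rw [FF_add, map_add]
    exact hx.add hy
  | smul c x _ hx =>
    rw [FF_smul, map_smul]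
    have := hx.const_mul (c : ℂ)
    rw [Algebra.smul_def]
    exact this

theorem om_norm (hr : r ≠ 0) (s : rootsOfUnity r ℂ) : ‖omr s‖ = 1 := by
  have h : (s : ℂˣ) ^ r = 1 := (mem_rootsOfUnity r _).mp s.2
  have h' : omr s ^ r = 1 := by
    rw [omr, ← Units.val_pow_eq_pow_val, h, Units.val_one]
  exact Complex.norm_eq_one_of_pow_eq_one h' hr

theorem om_re (hr : r ≠ 0) (s : rootsOfUnity r ℂ) (hs : s ≠ 1) : 0 < (1 - omr s).re := by
  have h := om_norm hr s
  rw [Complex.sub_re, Complex.one_re, sub_pos]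
  have h1 : (omr s).re ≤ 1 := h ▸ Complex.re_le_norm _
  refine lt_of_le_of_ne h1 fun he => hs ?_
  have h2 : omr s = 1 := by
    have h3 := Complex.sq_norm (omr s)
    rw [h, Complex.normSq_apply, he] at h3
    have h4 : (omr s).im = 0 := by nlinarith
    exact Complex.ext he h4
  apply Subtype.ext
  apply Units.ext
  exact h2

open scoped Classical in
/-- the parameters attached to the roots of unity -/
noncomputable def parr (hr : r ≠ 0) : Par (rootsOfUnity r ℂ) where
  c := fun s => if s = 1 then 1 else 1 - omr s
  hc := fun s => by
    split_ifs with h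
    · simp
    · exact om_re hr s h

theorem r_ne (L : Ar (rootsOfUnity r ℂ) →ₗ[ℚ] ℂ)
    (hLspec : ∀ (l : ℕ) (hl : 0 < l) (k : Fin l → ℕ) (s : Fin l → (rootsOfUnity r ℂ)),
      (∀ i, 1 ≤ k i) → (2 ≤ k ⟨0, hl⟩ ∨ s ⟨0, hl⟩ ≠ 1) →
      Filter.Tendsto (plSum r l k s) Filter.atTop (nhds (L (wAdm l k s)))) : r ≠ 0 := by
  rintro rfl
  let u : ℂˣ := Units.mk0 2 two_ne_zero
  have hu : u ∈ rootsOfUnity 0 ℂ := by rw [mem_rootsOfUnity, pow_zero]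
  let t : rootsOfUnity 0 ℂ := ⟨u, hu⟩
  have hot : omr t = 2 := rfl
  have ht : t ≠ 1 := by
    intro h
    have : omr t = 1 := by rw [h]; simp [omr]
    rw [hot] at this
    norm_num at this
  have h := hLspec 1 one_pos (fun _ => 1) (fun _ => t) (fun _ => le_rfl) (Or.inr ht)
  have h1 := (h.comp (tendsto_add_atTop_nat 1)).comp (tendsto_add_atTop_nat 1)
  have h2 := h.comp (tendsto_add_atTop_nat 1)
  have h3 := h1.sub h2
  rw [sub_self] at h3
  have e : ∀ n : ℕ, ((plSum 0 1 (fun _ => 1) (fun _ => t) ∘ fun a => a + 1) ∘ fun a => a + 1) n -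
      (plSum 0 1 (fun _ => 1) (fun _ => t) ∘ fun a => a + 1) n = 2 ^ (n + 1) / ((n + 1 : ℕ) : ℂ) := by
    intro n
    simp only [Function.comp_apply]
    rw [plSum_eq 1 _ _ (fun _ => le_rfl) _ (Nat.succ_pos _),
      plSum_eq 1 _ _ (fun _ => le_rfl) _ (Nat.succ_pos _), Finset.sum_range_succ, add_sub_cancel_left]
    simp [cf, hot, Finset.sum_range_succ']
  have h4 := h3.congr e
  have h5 := h4.norm
  rw [norm_zero] at h5
  have h6 := h5.eventually (gt_mem_nhds (zero_lt_one' ℝ))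
  obtain ⟨n, hn⟩ := h6.exists
  rw [norm_div, norm_pow, Complex.norm_natCast, Complex.norm_ofNat, div_lt_one (by positivity)] at hn
  have h7 : n + 1 < 2 ^ (n + 1) := Nat.lt_two_pow_self
  have h8 : ((n + 1 : ℕ) : ℝ) < 2 ^ (n + 1) := by exact_mod_cast h7
  linarith

end Final
end RTM

/-- For every `f ∈ Aug(H)`, the rooted tree map `f̃` sends `A_{r,+}^0` into the kernel of
the multiple `L`-value evaluation map `L` (which is `ℚ`-linear, sends `1` to `1`, and sends
each admissible word to the corresponding convergent multiple `L`-series). -/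
theorem statement19 (r : ℕ) {H : Type} [CommRing H] [HopfAlgebra ℚ H]
    (C : CKSetup (rootsOfUnity r ℂ) H)
    (L : Ar (rootsOfUnity r ℂ) →ₗ[ℚ] ℂ) (hL1 : L 1 = 1)
    (hLspec : ∀ (l : ℕ) (hl : 0 < l) (k : Fin l → ℕ) (s : Fin l → (rootsOfUnity r ℂ)),
      (∀ i, 1 ≤ k i) → (2 ≤ k ⟨0, hl⟩ ∨ s ⟨0, hl⟩ ≠ 1) →
      Filter.Tendsto (plSum r l k s) Filter.atTop (nhds (L (wAdm l k s))))
    (f : H) (hf : Coalgebra.counit (R := ℚ) f = 0) :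
    ∀ a ∈ A0plus (rootsOfUnity r ℂ), L (C.T f a) = 0 := by
  obtain ⟨u, hu⟩ := C.F_ends f hf
  have hr := RTM.r_ne L hLspec
  have hc1 : (RTM.parr hr).c 1 = 1 := by simp [RTM.parr]
  have hcs : ∀ s, s ≠ 1 → (RTM.parr hr).c s = 1 - RTM.omr s := by
    intro s hs
    simp [RTM.parr, hs]
  have hlim := RTM.lim_A0 (RTM.parr hr) hc1 hcs (fun s => (RTM.om_norm hr s).le) L hLspec
  obtain ⟨m, hm⟩ := RTM.limB (RTM.parr hr) C.ds u
  have hA : A0plus (rootsOfUnity r ℂ) ≤ LinearMap.ker (L ∘ₗ C.T f) := by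
    apply RTM.A0_le
    · intro s w hw
      rw [LinearMap.mem_ker, LinearMap.comp_apply, RTM.T_eq, hu]
      have h1 := hlim _ (RTM.zdel_Ey s _ (RTM.D_Ey C.ds s u w hw))
      have h2 := hm w s
      rw [RTM.ep_Ey w hw, Rat.cast_zero, zero_mul] at h2
      exact tendsto_nhds_unique h1 h2
    · intro s hs
      have key : ∀ t, L (C.T f (zdel t)) = m := by
        intro t
        have h0 := RTM.T_eq C f t 1
        rw [mul_one, hu] at h0
        rw [h0]
        have hE : C.ds.D t (u * Y1) 1 ∈ RTM.Ey (rootsOfUnity r ℂ) := by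
          rw [RTM.D_one']
          exact RTM.eh_Ey t u
        have h1 := hlim _ (RTM.zdel_Ey t _ hE)
        have h2 := hm 1 t
        rw [map_one (RTM.ep (rootsOfUnity r ℂ)), Rat.cast_one, one_mul] at h2
        exact tendsto_nhds_unique h1 h2
      have e : Yr s = zdel s - zdel 1 := by
        rw [RTM.zdel_one, zdel, if_neg hs, add_sub_cancel_left]
      rw [LinearMap.mem_ker, LinearMap.comp_apply, e, map_sub, map_sub, key, key, sub_self]
  intro a ha
  exact hA ha
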